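/- There is a constant K(f, I) such that for every integer J ≥ 2 and every λ ∈ (0,1/8], the sum of |μ(j₁,j₂,p₀,λ)| over all pairs (j₁,j₂) ∈ Θ₂ with |j₁| ≤ J, |j₂| ≤ J and ‖F(x₀)‖ ≥ 2λ is at most K(f,I)(λ^{1/2}J^{1/2} log J + λ J^{3/2}). -/

import Mathlib

open Set Real MeasureTheory
open scoped Classical

/-- Distance from a real number to the nearest integer. -/
noncomputable def nint (y : ℝ) : ℝ := |y - round y|

/-- Two convex functions `h`, `hd` with derivatives `g`, `gd` which are Legendre dual to each other
and whose second derivatives are bounded between multiples of `C⁻¹` and `C`. -/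
structure LegendrePair (C : ℝ) (h g hd gd : ℝ → ℝ) : Prop where
  one_le : 1 ≤ C
  left_inv : ∀ u, gd (g u) = u
  right_inv : ∀ s, g (gd s) = s
  dual : ∀ u, hd (g u) = u * g u - h u
  lower : ∀ u v, (v - u) ^ 2 ≤ C * (h v - h u - g u * (v - u))
  upper : ∀ u v, h v - h u - g u * (v - u) ≤ C * (v - u) ^ 2
  lower_dual : ∀ u v, (v - u) ^ 2 ≤ C * (hd v - hd u - gd u * (v - u))
  upper_dual : ∀ u v, hd v - hd u - gd u * (v - u) ≤ C * (v - u) ^ 2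

namespace LegendrePair

variable {C : ℝ} {h g hd gd : ℝ → ℝ}

lemma swap (D : LegendrePair C h g hd gd) : LegendrePair C hd gd h g where
  one_le := D.one_le
  left_inv := D.right_inv
  right_inv := D.left_inv
  dual := fun s => by
    have := D.dual (gd s)
    rw [D.right_inv] at this
    linarith
  lower := D.lower_dual
  upper := D.upper_dual
  lower_dual := D.lower
  upper_dual := D.upper

lemma reflect (D : LegendrePair C h g hd gd) :
    LegendrePair C (fun u => h (-u)) (fun u => -g (-u)) (fun s => hd (-s))
      (fun s => -gd (-s)) where
  one_le := D.one_le
  left_inv := fun u => by simp [D.left_inv]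
  right_inv := fun u => by simp [D.right_inv]
  dual := fun u => by simp [D.dual]
  lower := fun u v => by have := D.lower (-u) (-v); ring_nf at this ⊢; exact this
  upper := fun u v => by have := D.upper (-u) (-v); ring_nf at this ⊢; exact this
  lower_dual := fun u v => by have := D.lower_dual (-u) (-v); ring_nf at this ⊢; exact this
  upper_dual := fun u v => by have := D.upper_dual (-u) (-v); ring_nf at this ⊢; exact this

lemma deriv_lower (D : LegendrePair C h g hd gd) (u v : ℝ) :
    2 * (v - u) ^ 2 ≤ C * ((g v - g u) * (v - u)) := by
  nlinarith [D.lower u v, D.lower v u]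

lemma deriv_upper (D : LegendrePair C h g hd gd) (u v : ℝ) :
    |g v - g u| ≤ 2 * C * |v - u| := by
  have hC := D.one_le
  have h1 : (g v - g u) * (v - u) ≤ 2 * C * (v - u) ^ 2 := by
    nlinarith [D.upper u v, D.upper v u]
  have h0 : 0 ≤ (g v - g u) * (v - u) := by
    have := D.deriv_lower u v
    by_contra hn
    push Not at hn
    nlinarith [sq_nonneg (v - u)]
  rcases eq_or_ne v u with rfl | hne
  · simp
  have hpos : 0 < |v - u| := abs_pos.2 (sub_ne_zero.2 hne)
  have h2 : |g v - g u| * |v - u| ≤ 2 * C * |v - u| * |v - u| := by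
    rw [← abs_mul, abs_of_nonneg h0, mul_assoc (2 * C), abs_mul_abs_self]
    nlinarith
  exact le_of_mul_le_mul_right h2 hpos

/-- The vertical distance between the graph of `h` and a line of slope `s`. -/
lemma sub_line_eq (D : LegendrePair C h g hd gd) (s b u : ℝ) :
    h u - s * u + b = (h u - h (gd s) - g (gd s) * (u - gd s)) - (hd s - b) := by
  have := D.dual (gd s)
  rw [D.right_inv] at this ⊢
  linarith

lemma dist_tangency_sq_le (D : LegendrePair C h g hd gd) {s b w u : ℝ}
    (hu : |h u - s * u + b| ≤ w) : (u - gd s) ^ 2 ≤ C * (|hd s - b| + w) := by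
  rw [D.sub_line_eq] at hu
  have h1 := D.lower (gd s) u
  have hC := D.one_le
  have h2 := (abs_le.1 hu).2
  have h3 := le_abs_self (hd s - b)
  refine h1.trans (mul_le_mul_of_nonneg_left (by linarith) (by linarith))

lemma strip_right_sq (D : LegendrePair C h g hd gd) {s b w u₁ u₂ : ℝ} (hw : 0 < w)
    (h0 : gd s ≤ u₁) (h12 : u₁ ≤ u₂)
    (h1 : |h u₁ - s * u₁ + b| ≤ w) (h2 : |h u₂ - s * u₂ + b| ≤ w) :
    (u₂ - u₁) ^ 2 * max |hd s - b| w ≤ 4 * C ^ 3 * w ^ 2 := by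
  have hC := D.one_le
  have hd1 : |(h u₁ - h (gd s) - g (gd s) * (u₁ - gd s)) - (hd s - b)| ≤ w := by
    rwa [← D.sub_line_eq]
  have hlow1 := D.lower (gd s) u₁
  have hup1 := D.upper (gd s) u₁
  have hl12 := D.lower u₁ u₂
  have hdl := D.deriv_lower (gd s) u₁
  rw [D.right_inv] at hdl
  set m := hd s - b with hm
  have hdiff : h u₂ - h u₁ - s * (u₂ - u₁) ≤ 2 * w := by
    have a1 := (abs_le.1 h1).1
    have a2 := (abs_le.1 h2).2
    linarith
  have hg0 : 2 * (u₁ - gd s) ≤ C * (g u₁ - s) := by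
    rcases h0.eq_or_lt with he | hlt
    · rw [← he, D.right_inv]; simp
    · have hp : 0 < u₁ - gd s := by linarith
      have : 2 * (u₁ - gd s) * (u₁ - gd s) ≤ C * (g u₁ - s) * (u₁ - gd s) := by
        nlinarith
      exact le_of_mul_le_mul_right this hp
  set x := u₂ - u₁ with hx
  set y := u₁ - gd s with hy
  have hx0 : 0 ≤ x := by simp only [hx]; linarith
  have hy0 : 0 ≤ y := by simp only [hy]; linarith
  have key : x ^ 2 + 2 * y * x ≤ 2 * C * w := by
    have : 2 * y * x ≤ C * (g u₁ - s) * x := mul_le_mul_of_nonneg_right hg0 hx0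
    nlinarith
  have hx2 : x ^ 2 ≤ 2 * C * w := by nlinarith [mul_nonneg hy0 hx0]
  have hyx : y * x ≤ C * w := by nlinarith [sq_nonneg x]
  have hC3 : C ≤ C ^ 3 := by nlinarith [sq_nonneg (C - 1), mul_self_nonneg C]
  rcases le_or_gt |m| (2 * w) with hmw | hmw
  · have : max |m| w ≤ 2 * w := max_le hmw (by linarith)
    calc x ^ 2 * max |m| w ≤ (2 * C * w) * (2 * w) := by gcongr
      _ = 4 * C * w ^ 2 := by ring
      _ ≤ 4 * C ^ 3 * w ^ 2 := by gcongr
  · have hmax : max |m| w = |m| := max_eq_left (by linarith)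
    rw [hmax]
    have hdnn : 0 ≤ h u₁ - h (gd s) - g (gd s) * y := by
      by_contra hn
      push Not at hn
      nlinarith [sq_nonneg y]
    have a1 := abs_le.1 hd1
    have hmpos : 0 ≤ m := by
      by_contra hn
      push Not at hn
      rw [abs_of_neg hn] at hmw
      linarith
    rw [abs_of_nonneg hmpos] at hmw ⊢
    have hm2 : m ≤ 2 * C * y ^ 2 := by nlinarith
    calc x ^ 2 * m ≤ x ^ 2 * (2 * C * y ^ 2) := by gcongr
      _ = 2 * C * (y * x) ^ 2 := by ring
      _ ≤ 2 * C * (C * w) ^ 2 := by gcongr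
      _ ≤ 4 * C ^ 3 * w ^ 2 := by
        nlinarith [mul_nonneg (pow_nonneg (by linarith : 0 ≤ C) 3) (sq_nonneg w)]

/-- Two points on the same side of the point of tangency at which the curve `h` is `w`-close to a
line are close to each other. -/
lemma strip_right (D : LegendrePair C h g hd gd) {s b w u₁ u₂ : ℝ} (hw : 0 < w)
    (h01 : gd s ≤ u₁) (h02 : gd s ≤ u₂)
    (h1 : |h u₁ - s * u₁ + b| ≤ w) (h2 : |h u₂ - s * u₂ + b| ≤ w) :
    |u₂ - u₁| * √(max |hd s - b| w) ≤ 2 * C ^ 2 * w := by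
  have hC := D.one_le
  have hsq : (u₂ - u₁) ^ 2 * max |hd s - b| w ≤ 4 * C ^ 3 * w ^ 2 := by
    rcases le_total u₁ u₂ with h12 | h12
    · exact D.strip_right_sq hw h01 h12 h1 h2
    · have := D.strip_right_sq hw h02 h12 h2 h1
      rwa [← neg_sub, neg_sq] at this
  have hM : 0 ≤ max |hd s - b| w := le_max_of_le_right hw.le
  refine abs_le_of_sq_le_sq' ?_ (by positivity) |>.2
  rw [mul_pow, sq_abs, Real.sq_sqrt hM]
  refine hsq.trans ?_
  have : C ^ 3 ≤ C ^ 4 := pow_le_pow_right₀ hC (by norm_num)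
  calc 4 * C ^ 3 * w ^ 2 ≤ 4 * C ^ 4 * w ^ 2 := by gcongr
    _ = _ := by ring

lemma strip_left (D : LegendrePair C h g hd gd) {s b w u₁ u₂ : ℝ} (hw : 0 < w)
    (h01 : u₁ ≤ gd s) (h02 : u₂ ≤ gd s)
    (h1 : |h u₁ - s * u₁ + b| ≤ w) (h2 : |h u₂ - s * u₂ + b| ≤ w) :
    |u₂ - u₁| * √(max |hd s - b| w) ≤ 2 * C ^ 2 * w := by
  have := D.reflect.strip_right (s := -s) (b := b) (u₁ := -u₁) (u₂ := -u₂) hw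
    (by simpa using h01) (by simpa using h02) (by simpa using h1) (by simpa using h2)
  simp only [neg_neg] at this
  rwa [show -u₂ - -u₁ = -(u₂ - u₁) by ring, abs_neg] at this

end LegendrePair

/-- A triple `(a, q, b)` of integers without common factor. -/
def IsUnimodular (P : ℤ × ℤ × ℤ) : Prop :=
  ∃ x y z : ℤ, x * P.1 + y * P.2.1 + z * P.2.2 = 1

/-- The abscissa `a / q` of the rational point `(a / q, b / q)`. -/
noncomputable def absc (P : ℤ × ℤ × ℤ) : ℝ := (P.1 : ℝ) / (P.2.1 : ℝ)

/-- The ordinate `b / q` of the rational point `(a / q, b / q)`. -/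
noncomputable def ordi (P : ℤ × ℤ × ℤ) : ℝ := (P.2.2 : ℝ) / (P.2.1 : ℝ)

/-- The rational point encoded by `P` lies on the line `v = absc Λ * u - ordi Λ`. -/
def Incident (P Λ : ℤ × ℤ × ℤ) : Prop :=
  P.1 * Λ.1 = P.2.1 * Λ.2.2 + P.2.2 * Λ.2.1

lemma exists_unimodular_smul (a q b : ℤ) (hq : 0 < q) :
    ∃ d a' q' b' : ℤ, 0 < d ∧ 0 < q' ∧ a = d * a' ∧ q = d * q' ∧ b = d * b' ∧
      IsUnimodular (a', q', b') := by
  obtain ⟨d, hd⟩ : ∃ d : ℤ, Ideal.span {a, q, b} = Ideal.span {d} :=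
    (IsPrincipalIdealRing.principal (Ideal.span ({a, q, b} : Set ℤ))).principal
  have hda : d ∣ a := by
    rw [← Ideal.mem_span_singleton, ← hd]; exact Ideal.subset_span (by simp)
  have hdq : d ∣ q := by
    rw [← Ideal.mem_span_singleton, ← hd]; exact Ideal.subset_span (by simp)
  have hdb : d ∣ b := by
    rw [← Ideal.mem_span_singleton, ← hd]; exact Ideal.subset_span (by simp)
  have hmem : |d| ∈ Ideal.span ({a, q, b} : Set ℤ) := by
    rw [hd, Ideal.mem_span_singleton, dvd_abs]
  obtain ⟨x, y, z, hxyz⟩ : ∃ x y z : ℤ, x * a + y * q + z * b = |d| := by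
    rw [Ideal.mem_span_insert] at hmem
    obtain ⟨x, w, hw, hx⟩ := hmem
    rw [Ideal.mem_span_pair] at hw
    obtain ⟨y, z, hyz⟩ := hw
    exact ⟨x, y, z, by rw [hx, ← hyz]; ring⟩
  obtain ⟨a', rfl⟩ := (abs_dvd d a).2 hda
  obtain ⟨q', rfl⟩ := (abs_dvd d q).2 hdq
  obtain ⟨b', rfl⟩ := (abs_dvd d b).2 hdb
  have hd0 : 0 < |d| := by
    rcases (abs_nonneg d).eq_or_lt with h | h
    · rw [← h] at hq; simp at hq
    · exact h
  refine ⟨|d|, a', q', b', hd0, pos_of_mul_pos_right hq hd0.le, rfl, rfl, rfl, x, y, z, ?_⟩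
  have : |d| * (x * a' + y * q' + z * b') = |d| * 1 := by rw [mul_one]; linarith
  exact mul_left_cancel₀ hd0.ne' this

lemma IsUnimodular.eq_of_absc_eq {P P' : ℤ × ℤ × ℤ} (hP : IsUnimodular P)
    (hP' : IsUnimodular P') (hq : 0 < P.2.1) (hq' : 0 < P'.2.1) (hu : absc P = absc P')
    (hv : ordi P = ordi P') : P = P' := by
  obtain ⟨a, q, b⟩ := P
  obtain ⟨a', q', b'⟩ := P'
  simp only [absc, ordi] at hu hv hq hq'
  have hqR : (q : ℝ) ≠ 0 := by exact_mod_cast hq.ne'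
  have hqR' : (q' : ℝ) ≠ 0 := by exact_mod_cast hq'.ne'
  rw [div_eq_div_iff hqR hqR'] at hu hv
  have hu' : a * q' = a' * q := by exact_mod_cast hu
  have hv' : b * q' = b' * q := by exact_mod_cast hv
  obtain ⟨x, y, z, h1⟩ := hP
  obtain ⟨x', y', z', h1'⟩ := hP'
  simp only at h1 h1'
  have e1 : q' = q * (x * a' + y * q' + z * b') := by
    linear_combination (-q') * h1 + x * hu' + z * hv'
  have e2 : q = q' * (x' * a + y' * q + z' * b) := by
    linear_combination (-q) * h1' - x' * hu' - z' * hv'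
  have hqq : q = q' := Int.dvd_antisymm hq.le hq'.le ⟨_, e1⟩ ⟨_, e2⟩
  subst hqq
  have ha : a = a' := mul_right_cancel₀ hq.ne' hu'
  have hb : b = b' := mul_right_cancel₀ hq.ne' hv'
  rw [ha, hb]

lemma exists_incident_line {P P' : ℤ × ℤ × ℤ} (hne : P.1 * P'.2.1 ≠ P'.1 * P.2.1) :
    ∃ Λ : ℤ × ℤ × ℤ, IsUnimodular Λ ∧ 0 < Λ.2.1 ∧
      ∀ R : ℤ × ℤ × ℤ,
        R.1 * (P.2.1 * P'.2.2 - P.2.2 * P'.2.1) + R.2.1 * (P.2.2 * P'.1 - P.1 * P'.2.2)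
          + R.2.2 * (P.1 * P'.2.1 - P.2.1 * P'.1) = 0 → Incident R Λ := by
  obtain ⟨a, q, b⟩ := P
  obtain ⟨a', q', b'⟩ := P'
  simp only at hne ⊢
  have hne' : q * a' - a * q' ≠ 0 := fun h => hne (by linarith)
  rcases lt_or_gt_of_ne hne' with hlt | hgt
  · obtain ⟨d, A, Q, B, hd, hQ, hA', hQ', hB', hU⟩ := exists_unimodular_smul
      (-(q * b' - b * q')) (-(q * a' - a * q')) (-(a * b' - b * a')) (by linarith)
    refine ⟨(A, Q, B), hU, hQ, fun R hR => ?_⟩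
    simp only [Incident]
    refine mul_left_cancel₀ hd.ne' ?_
    linear_combination (-1 : ℤ) * hR - R.1 * hA' + R.2.1 * hB' + R.2.2 * hQ'
  · obtain ⟨d, A, Q, B, hd, hQ, hA', hQ', hB', hU⟩ := exists_unimodular_smul
      (q * b' - b * q') (q * a' - a * q') (a * b' - b * a') (by linarith)
    refine ⟨(A, Q, B), hU, hQ, fun R hR => ?_⟩
    simp only [Incident]
    refine mul_left_cancel₀ hd.ne' ?_
    linear_combination hR - R.1 * hA' + R.2.1 * hB' + R.2.2 * hQ'

lemma Incident.le_abs_sub {P P' Λ : ℤ × ℤ × ℤ} (hΛ : IsUnimodular Λ)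
    (h : Incident P Λ) (h' : Incident P' Λ) (hne : P.1 * P'.2.1 ≠ P'.1 * P.2.1) :
    Λ.2.1 ≤ |P.1 * P'.2.1 - P'.1 * P.2.1| := by
  obtain ⟨a, q, b⟩ := P
  obtain ⟨a', q', b'⟩ := P'
  obtain ⟨x, y, z, h1⟩ := hΛ
  obtain ⟨A, Q, B⟩ := Λ
  simp only [Incident] at *
  have hdvd : Q ∣ a * q' - a' * q := by
    refine ⟨x * (b * q' - q * b') + y * (a * q' - a' * q) + z * (b * a' - a * b'), ?_⟩
    linear_combination (-(a * q' - a' * q)) * h1 + x * (q' * h - q * h') + z * (a' * h - a * h')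
  exact Int.le_of_dvd (abs_pos.2 (sub_ne_zero.2 hne)) ((dvd_abs _ _).2 hdvd)

lemma Incident.ordi_eq {P Λ : ℤ × ℤ × ℤ} (h : Incident P Λ) (hP : 0 < P.2.1)
    (hΛ : 0 < Λ.2.1) : ordi P = absc Λ * absc P - ordi Λ := by
  have h1 : (P.2.1 : ℝ) ≠ 0 := by exact_mod_cast hP.ne'
  have h2 : (Λ.2.1 : ℝ) ≠ 0 := by exact_mod_cast hΛ.ne'
  have h3 : (P.1 : ℝ) * Λ.1 = P.2.1 * Λ.2.2 + P.2.2 * Λ.2.1 := by exact_mod_cast h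
  simp only [ordi, absc]
  field_simp
  linarith

lemma abs_absc_sub {P P' : ℤ × ℤ × ℤ} (hP : 0 < P.2.1) (hP' : 0 < P'.2.1) :
    |absc P - absc P'| * (P.2.1 * P'.2.1 : ℝ) = |((P.1 * P'.2.1 - P'.1 * P.2.1 : ℤ) : ℝ)| := by
  have h1 : (0 : ℝ) < P.2.1 := by exact_mod_cast hP
  have h2 : (0 : ℝ) < P'.2.1 := by exact_mod_cast hP'
  have h3 := mul_pos h1 h2
  have : |absc P - absc P'| * (P.2.1 * P'.2.1 : ℝ)
      = |(absc P - absc P') * (P.2.1 * P'.2.1 : ℝ)| := by rw [abs_mul, abs_of_pos h3]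
  rw [this]
  congr 1
  simp only [absc]
  push_cast
  field_simp

lemma card_separated_le {α : Type*} (S : Finset α) (u : α → ℝ) {σ D : ℝ} (hσ : 0 < σ)
    (hD : 0 ≤ D) (hsep : ∀ x ∈ S, ∀ y ∈ S, x ≠ y → σ ≤ |u x - u y|)
    (hdiam : ∀ x ∈ S, ∀ y ∈ S, |u x - u y| ≤ D) : ((S.card : ℝ) - 1) * σ ≤ D := by
  rcases S.eq_empty_or_nonempty with rfl | hne
  · simp; linarith
  obtain ⟨m, hm, hmin⟩ := S.exists_min_image u hne
  have hcard : S.card ≤ (Finset.Icc (0 : ℤ) ⌊D / σ⌋).card := by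
    refine Finset.card_le_card_of_injOn (fun x => ⌊(u x - u m) / σ⌋) ?_ ?_
    · intro x hx
      have hx' : x ∈ S := hx
      have h0 := hmin x hx'
      have h1 := (le_abs_self _).trans (hdiam x hx' m hm)
      simp only [Finset.coe_Icc, mem_Icc]
      refine ⟨Int.floor_nonneg.2 (div_nonneg (by linarith) hσ.le), Int.floor_le_floor ?_⟩
      gcongr
    · intro x hx y hy hxy
      by_contra hn
      have h1 := Int.abs_sub_lt_one_of_floor_eq_floor hxy
      rw [← sub_div, abs_div, abs_of_pos hσ, div_lt_one hσ] at h1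
      have h2 := hsep x hx y hy hn
      rw [show u x - u m - (u y - u m) = u x - u y by ring] at h1
      linarith
  have hfl : 0 ≤ ⌊D / σ⌋ := Int.floor_nonneg.2 (by positivity)
  rw [Int.card_Icc, sub_zero] at hcard
  have h3 : (S.card : ℤ) ≤ ⌊D / σ⌋ + 1 := by omega
  have h4 : (S.card : ℝ) ≤ ⌊D / σ⌋ + 1 := by exact_mod_cast h3
  have h5 := Int.floor_le (D / σ)
  calc ((S.card : ℝ) - 1) * σ ≤ (D / σ) * σ := by gcongr; linarith
    _ = D := by field_simp

/-- Points that lie on a line and are close to a curve are few. -/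
lemma card_incident_le {C : ℝ} {h g hd gd : ℝ → ℝ} (D : LegendrePair C h g hd gd)
    {Λ : ℤ × ℤ × ℤ} (hΛ : IsUnimodular Λ) (hΛq : 0 < Λ.2.1) {X w c : ℝ} (hw : 0 < w)
    (R : Finset (ℤ × ℤ × ℤ)) (hU : ∀ P ∈ R, IsUnimodular P)
    (hq : ∀ P ∈ R, 0 < P.2.1 ∧ (P.2.1 : ℝ) ≤ X) (hI : ∀ P ∈ R, Incident P Λ)
    (hnear : ∀ P ∈ R, |h (absc P) + c - ordi P| ≤ w) :
    ((R.card : ℝ) - 2) * (Λ.2.1 * √(max |hd (absc Λ) - c - ordi Λ| w))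
        ≤ 2 * (2 * C ^ 2 * w * X ^ 2) ∧
      ∀ ℓ : ℝ, 0 ≤ ℓ → (∀ P ∈ R, ∀ P' ∈ R, |absc P - absc P'| ≤ ℓ) →
        ((R.card : ℝ) - 2) * Λ.2.1 ≤ 2 * (ℓ * X ^ 2) := by
  rcases R.eq_empty_or_nonempty with rfl | ⟨P₀, hP₀⟩
  · have : (0 : ℝ) < Λ.2.1 := by exact_mod_cast hΛq
    have hC := D.one_le
    refine ⟨?_, fun ℓ hℓ _ => ?_⟩
    · simp only [Finset.card_empty, Nat.cast_zero, zero_sub]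
      have : 0 ≤ Λ.2.1 * √(max |hd (absc Λ) - c - ordi Λ| w) := by positivity
      have : 0 ≤ 2 * (2 * C ^ 2 * w * X ^ 2) := by positivity
      linarith
    · simp only [Finset.card_empty, Nat.cast_zero, zero_sub]
      have : 0 ≤ ℓ * X ^ 2 := by positivity
      linarith
  have hX : 0 < X := lt_of_lt_of_le (by exact_mod_cast (hq P₀ hP₀).1) (hq P₀ hP₀).2
  have hΛR : (0 : ℝ) < Λ.2.1 := by exact_mod_cast hΛq
  set M := max |hd (absc Λ) - c - ordi Λ| w with hM
  have hMpos : 0 < √M := Real.sqrt_pos.2 (lt_max_of_lt_right hw)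
  have hC := D.one_le
  have hsep : ∀ P ∈ R, ∀ P' ∈ R, P ≠ P' → (Λ.2.1 : ℝ) / X ^ 2 ≤ |absc P - absc P'| := by
    intro P hP P' hP' hne
    obtain ⟨q1, q2⟩ := hq P hP
    obtain ⟨q1', q2'⟩ := hq P' hP'
    have q1R : (0 : ℝ) < P.2.1 := by exact_mod_cast q1
    have q1R' : (0 : ℝ) < P'.2.1 := by exact_mod_cast q1'
    have hu : absc P ≠ absc P' := by
      intro hu
      refine hne ((hU P hP).eq_of_absc_eq (hU P' hP') q1 q1' hu ?_)
      rw [(hI P hP).ordi_eq q1 hΛq, (hI P' hP').ordi_eq q1' hΛq, hu]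
    have hcross : P.1 * P'.2.1 ≠ P'.1 * P.2.1 := by
      intro he
      apply hu
      simp only [absc]
      rw [div_eq_div_iff q1R.ne' q1R'.ne']
      exact_mod_cast he
    have h1 := (hI P hP).le_abs_sub hΛ (hI P' hP') hcross
    have h2 := abs_absc_sub q1 q1'
    have h3 : (Λ.2.1 : ℝ) ≤ |((P.1 * P'.2.1 - P'.1 * P.2.1 : ℤ) : ℝ)| := by exact_mod_cast h1
    rw [div_le_iff₀ (by positivity)]
    rw [← h2] at h3
    refine h3.trans (mul_le_mul_of_nonneg_left ?_ (abs_nonneg _))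
    rw [pow_two]
    exact mul_le_mul q2 q2' q1R'.le hX.le
  have hline : ∀ P ∈ R, |h (absc P) - absc Λ * absc P + (ordi Λ + c)| ≤ w := by
    intro P hP
    have := hnear P hP
    rw [(hI P hP).ordi_eq (hq P hP).1 hΛq] at this
    rwa [show h (absc P) + c - (absc Λ * absc P - ordi Λ)
      = h (absc P) - absc Λ * absc P + (ordi Λ + c) by ring] at this
  have hMeq : M = max |hd (absc Λ) - (ordi Λ + c)| w := by
    rw [hM, show hd (absc Λ) - c - ordi Λ = hd (absc Λ) - (ordi Λ + c) by ring]
  set R₁ := R.filter (fun P => gd (absc Λ) ≤ absc P) with hR₁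
  set R₂ := R.filter (fun P => ¬ gd (absc Λ) ≤ absc P) with hR₂
  have hcard : (R.card : ℝ) = R₁.card + R₂.card := by
    have := Finset.card_filter_add_card_filter_not (s := R) (fun P => gd (absc Λ) ≤ absc P)
    rw [hR₁, hR₂]
    exact_mod_cast this.symm
  have hσ : 0 < (Λ.2.1 : ℝ) / X ^ 2 := by positivity
  have hall : ∀ d₁ : ℝ, 0 ≤ d₁ →
      (∀ P ∈ R₁, ∀ P' ∈ R₁, |absc P - absc P'| ≤ d₁) →
      (∀ P ∈ R₂, ∀ P' ∈ R₂, |absc P - absc P'| ≤ d₁) →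
      ((R.card : ℝ) - 2) * Λ.2.1 ≤ 2 * (d₁ * X ^ 2) := by
    intro d₁ hd₁ hA hB
    have h1 := card_separated_le R₁ absc hσ hd₁ (fun x hx y hy =>
      hsep x (Finset.mem_of_mem_filter x hx) y (Finset.mem_of_mem_filter y hy)) hA
    have h2 := card_separated_le R₂ absc hσ hd₁ (fun x hx y hy =>
      hsep x (Finset.mem_of_mem_filter x hx) y (Finset.mem_of_mem_filter y hy)) hB
    rw [← mul_div_assoc, div_le_iff₀ (by positivity)] at h1 h2
    rw [hcard]
    linarith
  refine ⟨?_, fun ℓ hℓ hd => hall ℓ hℓ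
    (fun x hx y hy => hd x (Finset.mem_of_mem_filter x hx) y (Finset.mem_of_mem_filter y hy))
    (fun x hx y hy => hd x (Finset.mem_of_mem_filter x hx) y (Finset.mem_of_mem_filter y hy))⟩
  have hfin := hall (2 * C ^ 2 * w / √M) (by positivity) ?_ ?_
  · calc ((R.card : ℝ) - 2) * (Λ.2.1 * √M) = (((R.card : ℝ) - 2) * Λ.2.1) * √M := by ring
      _ ≤ (2 * (2 * C ^ 2 * w / √M * X ^ 2)) * √M := by gcongr
      _ = _ := by field_simp
  · intro P hP P' hP'
    rw [hR₁, Finset.mem_filter] at hP hP'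
    rw [le_div_iff₀ hMpos, hMeq]
    exact D.strip_right hw hP'.2 hP.2 (hline _ hP'.1) (hline _ hP.1)
  · intro P hP P' hP'
    rw [hR₂, Finset.mem_filter] at hP hP'
    rw [le_div_iff₀ hMpos, hMeq]
    exact D.strip_left hw (not_le.1 hP'.2).le (not_le.1 hP.2).le (hline _ hP'.1) (hline _ hP.1)

/-- Three rational points of small height in a small cell along a curve are collinear. -/
lemma det_eq_zero_of_close {C : ℝ} {h g hd gd : ℝ → ℝ} (D : LegendrePair C h g hd gd)
    {X ℓ ω : ℝ} (hℓ : 0 ≤ ℓ) (hsmall : 2 * ℓ * (C * ℓ ^ 2 + ω) * X ^ 3 < 1)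
    {P P' R : ℤ × ℤ × ℤ} (hP : 0 < P.2.1) (hP' : 0 < P'.2.1) (hR : 0 < R.2.1)
    (hPX : (P.2.1 : ℝ) ≤ X) (hPX' : (P'.2.1 : ℝ) ≤ X) (hRX : (R.2.1 : ℝ) ≤ X)
    (hu : |absc P' - absc P| ≤ ℓ) (huR : |absc R - absc P| ≤ ℓ)
    (he : |(ordi P' - h (absc P')) - (ordi P - h (absc P))| ≤ ω)
    (heR : |(ordi R - h (absc R)) - (ordi P - h (absc P))| ≤ ω) :
    R.1 * (P.2.1 * P'.2.2 - P.2.2 * P'.2.1) + R.2.1 * (P.2.2 * P'.1 - P.1 * P'.2.2)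
          + R.2.2 * (P.1 * P'.2.1 - P.2.1 * P'.1) = 0 := by
  have hC := D.one_le
  have q1 : (0 : ℝ) < P.2.1 := by exact_mod_cast hP
  have q2 : (0 : ℝ) < P'.2.1 := by exact_mod_cast hP'
  have q3 : (0 : ℝ) < R.2.1 := by exact_mod_cast hR
  have hX : 0 < X := q1.trans_le hPX
  set Δ : ℤ := R.1 * (P.2.1 * P'.2.2 - P.2.2 * P'.2.1) + R.2.1 * (P.2.2 * P'.1 - P.1 * P'.2.2)
          + R.2.2 * (P.1 * P'.2.1 - P.2.1 * P'.1) with hΔ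
  have hrem : ∀ y : ℝ, |y - absc P| ≤ ℓ →
      |h y - h (absc P) - g (absc P) * (y - absc P)| ≤ C * ℓ ^ 2 := by
    intro y hy
    have h1 := D.upper (absc P) y
    have h2 := D.lower (absc P) y
    have h3 : 0 ≤ h y - h (absc P) - g (absc P) * (y - absc P) := by
      by_contra hn
      push Not at hn
      nlinarith [sq_nonneg (y - absc P)]
    rw [abs_of_nonneg h3]
    refine h1.trans ?_
    rw [← sq_abs (y - absc P)]
    gcongr
  have hb : ∀ Q : ℤ × ℤ × ℤ, |absc Q - absc P| ≤ ℓ →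
      |(ordi Q - h (absc Q)) - (ordi P - h (absc P))| ≤ ω →
      |ordi Q - ordi P - g (absc P) * (absc Q - absc P)| ≤ C * ℓ ^ 2 + ω := by
    intro Q hQ hQ'
    have := hrem _ hQ
    calc |ordi Q - ordi P - g (absc P) * (absc Q - absc P)|
        = |(h (absc Q) - h (absc P) - g (absc P) * (absc Q - absc P))
          + ((ordi Q - h (absc Q)) - (ordi P - h (absc P)))| := by congr 1; ring
      _ ≤ _ := (abs_add_le _ _).trans (add_le_add this hQ')
  have hΔR : (Δ : ℝ) = (P.2.1 * P'.2.1 * R.2.1 : ℝ) *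
      ((absc R - absc P) * (ordi P' - ordi P - g (absc P) * (absc P' - absc P))
        - (absc P' - absc P) * (ordi R - ordi P - g (absc P) * (absc R - absc P))) := by
    rw [hΔ]
    simp only [absc, ordi]
    push_cast
    field_simp
    ring
  have hbr : |(absc R - absc P) * (ordi P' - ordi P - g (absc P) * (absc P' - absc P))
        - (absc P' - absc P) * (ordi R - ordi P - g (absc P) * (absc R - absc P))|
      ≤ 2 * ℓ * (C * ℓ ^ 2 + ω) := by
    refine (abs_sub _ _).trans ?_
    rw [abs_mul, abs_mul]
    have h1 := mul_le_mul huR (hb P' hu he) (abs_nonneg _) hℓ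
    have h2 := mul_le_mul hu (hb R huR heR) (abs_nonneg _) hℓ
    linarith
  have hlt : |(Δ : ℝ)| < 1 := by
    rw [hΔR, abs_mul, abs_of_pos (by positivity)]
    calc _ ≤ (X * X * X) * (2 * ℓ * (C * ℓ ^ 2 + ω)) := by gcongr
      _ = 2 * ℓ * (C * ℓ ^ 2 + ω) * X ^ 3 := by ring
      _ < 1 := hsmall
  have : |Δ| < 1 := by exact_mod_cast hlt
  exact Int.abs_lt_one_iff.1 this

lemma exists_line_of_cell {C : ℝ} {h g hd gd : ℝ → ℝ} (D : LegendrePair C h g hd gd)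
    {X ℓ ω : ℝ} (hℓ : 0 ≤ ℓ) (hω : 0 ≤ ω) (hsmall : 2 * ℓ * (C * ℓ ^ 2 + ω) * X ^ 3 < 1)
    (hωX : ω * X ^ 2 < 1) (T : Finset (ℤ × ℤ × ℤ)) (hT : 1 < T.card)
    (hU : ∀ P ∈ T, IsUnimodular P) (hq : ∀ P ∈ T, 0 < P.2.1 ∧ (P.2.1 : ℝ) ≤ X)
    (hu : ∀ P ∈ T, ∀ P' ∈ T, |absc P - absc P'| ≤ ℓ)
    (he : ∀ P ∈ T, ∀ P' ∈ T, |(ordi P - h (absc P)) - (ordi P' - h (absc P'))| ≤ ω) :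
    ∃ Λ : ℤ × ℤ × ℤ, IsUnimodular Λ ∧ 0 < Λ.2.1 ∧ ∀ R ∈ T, Incident R Λ := by
  obtain ⟨P, hP, P', hP', hne⟩ := Finset.one_lt_card.1 hT
  obtain ⟨q1, q2⟩ := hq P hP
  obtain ⟨q1', q2'⟩ := hq P' hP'
  have q1R : (0 : ℝ) < P.2.1 := by exact_mod_cast q1
  have q1R' : (0 : ℝ) < P'.2.1 := by exact_mod_cast q1'
  have hcross : P.1 * P'.2.1 ≠ P'.1 * P.2.1 := by
    intro hc
    have huu : absc P = absc P' := by
      simp only [absc]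
      rw [div_eq_div_iff q1R.ne' q1R'.ne']
      exact_mod_cast hc
    have hvv : ordi P ≠ ordi P' := fun hv =>
      hne ((hU P hP).eq_of_absc_eq (hU P' hP') q1 q1' huu hv)
    have hle := he P hP P' hP'
    rw [huu, sub_sub_sub_cancel_right] at hle
    have hint : P.2.2 * P'.2.1 - P'.2.2 * P.2.1 ≠ 0 := by
      intro h0
      apply hvv
      simp only [ordi]
      rw [div_eq_div_iff q1R.ne' q1R'.ne']
      exact_mod_cast sub_eq_zero.1 h0
    have h1 : (1 : ℝ) ≤ |((P.2.2 * P'.2.1 - P'.2.2 * P.2.1 : ℤ) : ℝ)| := by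
      exact_mod_cast Int.one_le_abs hint
    have h2 : |((P.2.2 * P'.2.1 - P'.2.2 * P.2.1 : ℤ) : ℝ)|
        = |ordi P - ordi P'| * (P.2.1 * P'.2.1) := by
      have h4 : |ordi P - ordi P'| * (P.2.1 * P'.2.1 : ℝ)
          = |(ordi P - ordi P') * (P.2.1 * P'.2.1 : ℝ)| := by
        rw [abs_mul, abs_of_pos (mul_pos q1R q1R')]
      rw [h4]
      congr 1
      simp only [ordi]
      push_cast
      field_simp
    rw [h2] at h1
    have hX : 0 < X := q1R.trans_le q2
    have h3 : |ordi P - ordi P'| * (P.2.1 * P'.2.1) ≤ ω * (X * X) := by gcongr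
    nlinarith
  obtain ⟨Λ, hΛ, hΛq, hinc⟩ := exists_incident_line hcross
  refine ⟨Λ, hΛ, hΛq, fun R hR => hinc R ?_⟩
  obtain ⟨q3, q4⟩ := hq R hR
  exact det_eq_zero_of_close D hℓ hsmall q1 q1' q3 q2 q2' q4 (hu _ hP' _ hP) (hu _ hR _ hP)
    (he _ hP' _ hP) (he _ hR _ hP)

lemma card_le_sparse_add {α β : Type*} [DecidableEq β] (S : Finset α) (c : α → β) (K : ℕ) :
    S.card ≤ K * (S.image c).card +
      (S.filter (fun x => K < (S.filter (fun y => c y = c x)).card)).card := by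
  set B := S.filter (fun x => K < (S.filter (fun y => c y = c x)).card) with hB
  set A := S.filter (fun x => ¬ K < (S.filter (fun y => c y = c x)).card) with hA
  have h1 : B.card + A.card = S.card := Finset.card_filter_add_card_filter_not _
  have h2 : A.card ≤ K * (S.image c).card := by
    refine Finset.card_le_mul_card_image_of_maps_to (f := c) ?_ K ?_
    · intro x hx
      exact Finset.mem_image_of_mem c (Finset.mem_of_mem_filter x hx)
    · intro b hb
      rcases (A.filter (fun a => c a = b)).eq_empty_or_nonempty with he | ⟨x, hx⟩
      · rw [he]; simp
      · obtain ⟨hxA, rfl⟩ := Finset.mem_filter.1 hx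
        obtain ⟨_, hx2⟩ := Finset.mem_filter.1 hxA
        refine (Finset.card_le_card ?_).trans (not_lt.1 hx2)
        exact Finset.filter_subset_filter _ (Finset.filter_subset _ _)
  omega

lemma card_Icc_floor_le (x y : ℝ) (hxy : x ≤ y) :
    ((Finset.Icc ⌊x⌋ ⌊y⌋).card : ℝ) ≤ y - x + 2 := by
  rw [Int.card_Icc]
  have h1 := Int.floor_le_floor hxy
  have h2 : ((⌊y⌋ + 1 - ⌊x⌋).toNat : ℤ) = ⌊y⌋ + 1 - ⌊x⌋ := Int.toNat_of_nonneg (by omega)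
  have h3 : (((⌊y⌋ + 1 - ⌊x⌋).toNat : ℤ) : ℝ) = ⌊y⌋ + 1 - ⌊x⌋ := by rw [h2]; push_cast; ring
  rw [Int.cast_natCast] at h3
  rw [h3]
  have := Int.floor_le y
  have := Int.lt_floor_add_one x
  linarith

/-- A finite set of primitive rational points near a curve, of height at most `X` and abscissa in
`[z, z + 1)`. -/
def NearPoints (h : ℝ → ℝ) (X w z : ℝ) (S : Finset (ℤ × ℤ × ℤ)) : Prop :=
  ∀ P ∈ S, IsUnimodular P ∧ (0 < P.2.1 ∧ (P.2.1 : ℝ) ≤ X) ∧ (z ≤ absc P ∧ absc P < z + 1) ∧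
    |h (absc P) - ordi P| ≤ w

/-- The thickened distance of the dual point `Λ` to the dual curve of the `i`-th translate. -/
noncomputable def thick (hd : ℝ → ℝ) (ω : ℝ) (p : (ℤ × ℤ × ℤ) × ℤ) : ℝ :=
  √(max |hd (absc p.1) - p.2 * ω - ordi p.1| ω)

lemma card_le_cells_add_lines {C : ℝ} {h g hd gd : ℝ → ℝ} (D : LegendrePair C h g hd gd)
    {X w z ω : ℝ} (hX : 1 ≤ X) (hw : 0 < w) (hω : 0 < ω) (hωX : 4 * C ^ 2 * (ω * X ^ 2) ≤ 1)
    (N : ℕ) (hN : 1 ≤ N) {S : Finset (ℤ × ℤ × ℤ)} (hS : NearPoints h X w z S) :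
    ∃ E : Finset ((ℤ × ℤ × ℤ) × ℤ),
      (∀ p ∈ E, IsUnimodular p.1 ∧ 0 < p.1.2.1 ∧ (N : ℝ) * p.1.2.1 ≤ X ∧
        N * (p.1.2.1 * thick hd ω p) ≤ 2 * C ^ 2 * ω * X ^ 2 ∧ |(p.2 : ℝ)| * ω ≤ w + ω ∧
        |absc p.1 - g z| ≤ 4 * C ^ 2) ∧
      (S.card : ℝ) ≤ (2 * N + 1) * ((2 * C * X + 2) * (2 * (w / ω) + 2)) +
        ∑ p ∈ E, 4 * (2 * C ^ 2 * ω * X ^ 2) / (p.1.2.1 * thick hd ω p) := by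
  have hC := D.one_le
  have hC0 : 0 < C := by linarith
  have hX0 : 0 < X := by linarith
  set ℓ : ℝ := 1 / (2 * C * X) with hℓ
  have hℓ0 : 0 < ℓ := by positivity
  have hℓX : ℓ * X ^ 2 ≤ X := by
    rw [hℓ]; field_simp; linarith
  set c : ℤ × ℤ × ℤ → ℤ × ℤ := fun P => (⌊absc P / ℓ⌋, ⌊(ordi P - h (absc P)) / ω⌋) with hc
  have hcu : ∀ P P', c P = c P' → |absc P - absc P'| ≤ ℓ := by
    intro P P' hPP
    have := Int.abs_sub_lt_one_of_floor_eq_floor (congrArg Prod.fst hPP)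
    rw [← sub_div, abs_div, abs_of_pos hℓ0, div_lt_one hℓ0] at this
    exact this.le
  have hce : ∀ P P', c P = c P' →
      |(ordi P - h (absc P)) - (ordi P' - h (absc P'))| ≤ ω := by
    intro P P' hPP
    have := Int.abs_sub_lt_one_of_floor_eq_floor (congrArg Prod.snd hPP)
    rw [← sub_div, abs_div, abs_of_pos hω, div_lt_one hω] at this
    exact this.le
  have hci : ∀ P, |h (absc P) + (c P).2 * ω - ordi P| ≤ ω := by
    intro P
    have h1 := Int.floor_le ((ordi P - h (absc P)) / ω)
    have h2 := Int.lt_floor_add_one ((ordi P - h (absc P)) / ω)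
    rw [le_div_iff₀ hω] at h1
    rw [div_lt_iff₀ hω] at h2
    simp only [hc]
    rw [abs_le]
    constructor <;> linarith
  set B := S.filter (fun x => 2 * N + 1 < (S.filter (fun y => c y = c x)).card) with hB
  have hsmall : 2 * ℓ * (C * ℓ ^ 2 + ω) * X ^ 3 < 1 := by
    have e1 : 2 * ℓ * (C * ℓ ^ 2 + ω) * X ^ 3 = (1 / C) * (1 / (4 * C) + ω * X ^ 2) := by
      rw [hℓ]; field_simp; ring
    rw [e1]
    have h1 : 1 / C ≤ 1 := by rw [div_le_one hC0]; exact hC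
    have h2 : 1 / (4 * C) ≤ 1 / 4 := by
      apply one_div_le_one_div_of_le <;> linarith
    have h3 : ω * X ^ 2 ≤ 1 / 4 := by
      have : ω * X ^ 2 ≤ C ^ 2 * (ω * X ^ 2) :=
        le_mul_of_one_le_left (by positivity) (one_le_pow₀ hC)
      linarith
    have h4 : 0 < 1 / C := by positivity
    nlinarith
  have hωX1 : ω * X ^ 2 < 1 := by
    have : ω * X ^ 2 ≤ C ^ 2 * (ω * X ^ 2) :=
        le_mul_of_one_le_left (by positivity) (one_le_pow₀ hC)
    linarith
  have hex : ∀ k : ℤ × ℤ, ∃ Λ : ℤ × ℤ × ℤ, 2 * N + 1 < (S.filter (fun y => c y = k)).card →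
      IsUnimodular Λ ∧ 0 < Λ.2.1 ∧ ∀ R ∈ S.filter (fun y => c y = k), Incident R Λ := by
    intro k
    by_cases hk : 2 * N + 1 < (S.filter (fun y => c y = k)).card
    · obtain ⟨Λ, h1⟩ := exists_line_of_cell D hℓ0.le hω.le hsmall hωX1
        (S.filter (fun y => c y = k)) (by omega)
        (fun P hP => (hS P (Finset.mem_of_mem_filter P hP)).1)
        (fun P hP => (hS P (Finset.mem_of_mem_filter P hP)).2.1)
        (fun P hP P' hP' => hcu _ _ ((Finset.mem_filter.1 hP).2.trans
          (Finset.mem_filter.1 hP').2.symm))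
        (fun P hP P' hP' => hce _ _ ((Finset.mem_filter.1 hP).2.trans
          (Finset.mem_filter.1 hP').2.symm))
      exact ⟨Λ, fun _ => h1⟩
    · exact ⟨(0, 0, 0), fun h => absurd h hk⟩
  choose L hL using hex
  set pr : ℤ × ℤ × ℤ → (ℤ × ℤ × ℤ) × ℤ := fun P => (L (c P), (c P).2) with hpr
  have hthick : ∀ p, 0 < thick hd ω p := fun p => Real.sqrt_pos.2 (lt_max_of_lt_right hω)
  have hgood : ∀ p ∈ B.image pr, IsUnimodular p.1 ∧ 0 < p.1.2.1 ∧ (N : ℝ) * p.1.2.1 ≤ X ∧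
        N * (p.1.2.1 * thick hd ω p) ≤ 2 * C ^ 2 * ω * X ^ 2 ∧ |(p.2 : ℝ)| * ω ≤ w + ω ∧
        |absc p.1 - g z| ≤ 4 * C ^ 2 := by
    intro p hp
    obtain ⟨P, hPB, rfl⟩ := Finset.mem_image.1 hp
    obtain ⟨hPS, hdense⟩ := Finset.mem_filter.1 hPB
    obtain ⟨hU, hQ, hI⟩ := hL (c P) hdense
    obtain ⟨-, -, ⟨hz1, hz2⟩, hPw⟩ := hS P hPS
    have hQR : (1 : ℝ) ≤ (L (c P)).2.1 := by exact_mod_cast hQ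
    have hmem : ∀ {R}, R ∈ S.filter (fun y => c y = c P) → R ∈ S ∧ c R = c P :=
      fun hR => Finset.mem_filter.1 hR
    obtain ⟨hA, hA'⟩ := card_incident_le D hU hQ (X := X) (w := ω) (c := (c P).2 * ω) hω
      (S.filter (fun y => c y = c P)) (fun R hR => (hS R (hmem hR).1).1)
      (fun R hR => (hS R (hmem hR).1).2.1) hI
      (fun R hR => by rw [← (hmem hR).2]; exact hci R)
    have hAl := hA' ℓ hℓ0.le (fun R hR R' hR' => hcu _ _ ((hmem hR).2.trans (hmem hR').2.symm))
    have hcd : (2 * N : ℝ) ≤ ((S.filter (fun y => c y = c P)).card : ℝ) - 2 := by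
      have : 2 * N + 2 ≤ (S.filter (fun y => c y = c P)).card := hdense
      have : (2 * N + 2 : ℝ) ≤ ((S.filter (fun y => c y = c P)).card : ℝ) := by
        exact_mod_cast this
      linarith
    have hthP := hthick (pr P)
    have h1 : (N : ℝ) * (L (c P)).2.1 ≤ X := by
      have : (2 * N : ℝ) * (L (c P)).2.1 ≤ 2 * (ℓ * X ^ 2) :=
        (mul_le_mul_of_nonneg_right hcd (by linarith)).trans hAl
      linarith
    have h2 : N * ((L (c P)).2.1 * thick hd ω (pr P)) ≤ 2 * C ^ 2 * ω * X ^ 2 := by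
      have : (2 * N : ℝ) * ((L (c P)).2.1 * thick hd ω (pr P)) ≤ 2 * (2 * C ^ 2 * ω * X ^ 2) :=
        (mul_le_mul_of_nonneg_right hcd (by positivity)).trans hA
      linarith
    refine ⟨hU, hQ, h1, h2, ?_, ?_⟩
    · have e1 := abs_le.1 (hci P)
      have e2 := abs_le.1 hPw
      rw [← abs_of_pos hω, ← abs_mul, abs_of_pos hω, abs_le]
      simp only [hpr]
      constructor <;> linarith
    · have hNR : (1 : ℝ) ≤ N := by exact_mod_cast hN
      have hth1 : thick hd ω (pr P) ≤ 1 / 2 := by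
        have : 1 * (1 * thick hd ω (pr P)) ≤ N * ((L (c P)).2.1 * thick hd ω (pr P)) := by
          gcongr
        nlinarith
      have hmax : max |hd (absc (L (c P))) - (c P).2 * ω - ordi (L (c P))| ω ≤ 1 / 4 := by
        have hsq : (thick hd ω (pr P)) ^ 2
            = max |hd (absc (L (c P))) - (c P).2 * ω - ordi (L (c P))| ω :=
          Real.sq_sqrt (le_max_of_le_right hω.le)
        rw [← hsq]
        nlinarith
      have hPq : 0 < P.2.1 := (hS P hPS).2.1.1
      have hPI := hI P (Finset.mem_filter.2 ⟨hPS, rfl⟩)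
      have htan := D.dist_tangency_sq_le (s := absc (L (c P)))
        (b := ordi (L (c P)) + (c P).2 * ω) (w := ω) (u := absc P) (by
          have := hci P
          rw [hPI.ordi_eq hPq hQ] at this
          rwa [show h (absc P) + (c P).2 * ω - (absc (L (c P)) * absc P - ordi (L (c P)))
            = h (absc P) - absc (L (c P)) * absc P + (ordi (L (c P)) + (c P).2 * ω) by ring]
            at this)
      have hle1 := (le_max_left |hd (absc (L (c P))) - (c P).2 * ω - ordi (L (c P))| ω).trans hmax
      have hle2 := (le_max_right |hd (absc (L (c P))) - (c P).2 * ω - ordi (L (c P))| ω).trans hmax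
      have htan2 : (absc P - gd (absc (L (c P)))) ^ 2 ≤ 1 * C ^ 2 := by
        refine htan.trans ?_
        rw [show hd (absc (L (c P))) - (ordi (L (c P)) + (c P).2 * ω)
          = hd (absc (L (c P))) - (c P).2 * ω - ordi (L (c P)) by ring]
        nlinarith
      have htan3 : |absc P - gd (absc (L (c P)))| ≤ C := by
        rw [one_mul] at htan2
        exact abs_le_of_sq_le_sq htan2 hC0.le
      have hdu := D.deriv_upper z (gd (absc (L (c P))))
      rw [D.right_inv] at hdu
      refine hdu.trans ?_
      have : |gd (absc (L (c P))) - z| ≤ C + 1 := by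
        have := abs_le.1 htan3
        rw [abs_le]
        constructor <;> linarith
      calc 2 * C * |gd (absc (L (c P))) - z| ≤ 2 * C * (C + 1) := by gcongr
        _ ≤ 4 * C ^ 2 := by nlinarith
  refine ⟨B.image pr, hgood, ?_⟩
  have hsp := card_le_sparse_add S c (2 * N + 1)
  have hBcard : (B.card : ℝ)
      ≤ ∑ p ∈ B.image pr, 4 * (2 * C ^ 2 * ω * X ^ 2) / (p.1.2.1 * thick hd ω p) := by
    rw [Finset.card_eq_sum_card_image pr B]
    push_cast
    refine Finset.sum_le_sum fun p hp => ?_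
    obtain ⟨hU, hQ, h1, h2, -⟩ := hgood p hp
    have hQR : (0 : ℝ) < p.1.2.1 := by exact_mod_cast hQ
    have hthP := hthick p
    have hinfib : ∀ {R}, R ∈ B.filter (fun x => pr x = p) → R ∈ S ∧ Incident R p.1 ∧
        (c R).2 = p.2 := by
      intro R hR
      obtain ⟨hRB, rfl⟩ := Finset.mem_filter.1 hR
      obtain ⟨hRS, hdense⟩ := Finset.mem_filter.1 hRB
      exact ⟨hRS, (hL (c R) hdense).2.2 R (Finset.mem_filter.2 ⟨hRS, rfl⟩), rfl⟩
    obtain ⟨hA, -⟩ := card_incident_le D hU hQ (X := X) (w := ω) (c := p.2 * ω) hω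
      (B.filter (fun x => pr x = p)) (fun R hR => (hS R (hinfib hR).1).1)
      (fun R hR => (hS R (hinfib hR).1).2.1) (fun R hR => (hinfib hR).2.1)
      (fun R hR => by rw [← (hinfib hR).2.2]; exact hci R)
    rw [le_div_iff₀ (by positivity)]
    change (_ - 2) * (p.1.2.1 * thick hd ω p) ≤ _ at hA
    have hNR : (1 : ℝ) ≤ N := by exact_mod_cast hN
    have : 1 * (p.1.2.1 * thick hd ω p) ≤ N * (p.1.2.1 * thick hd ω p) := by gcongr
    linarith
  have himg : ((S.image c).card : ℝ) ≤ (2 * C * X + 2) * (2 * (w / ω) + 2) := by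
    have hsub : S.image c ⊆ Finset.Icc ⌊z / ℓ⌋ ⌊(z + 1) / ℓ⌋ ×ˢ Finset.Icc ⌊(-w) / ω⌋ ⌊w / ω⌋ := by
      intro k hk
      obtain ⟨P, hP, rfl⟩ := Finset.mem_image.1 hk
      obtain ⟨-, -, ⟨hz1, hz2⟩, hPw⟩ := hS P hP
      have e2 := abs_le.1 hPw
      simp only [hc, Finset.mem_product, Finset.mem_Icc]
      refine ⟨⟨Int.floor_le_floor ?_, Int.floor_le_floor ?_⟩,
        Int.floor_le_floor ?_, Int.floor_le_floor ?_⟩ <;> gcongr <;> linarith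
    have h1 := Finset.card_le_card hsub
    rw [Finset.card_product] at h1
    have h2 := card_Icc_floor_le (z / ℓ) ((z + 1) / ℓ) (by gcongr; linarith)
    have h3 := card_Icc_floor_le ((-w) / ω) (w / ω) (by gcongr; linarith)
    have e1 : (z + 1) / ℓ - z / ℓ + 2 = 2 * C * X + 2 := by rw [hℓ]; field_simp; ring
    have e2 : w / ω - (-w) / ω + 2 = 2 * (w / ω) + 2 := by ring
    rw [e1] at h2
    rw [e2] at h3
    calc ((S.image c).card : ℝ) ≤ ((Finset.Icc ⌊z / ℓ⌋ ⌊(z + 1) / ℓ⌋).card : ℝ) *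
          ((Finset.Icc ⌊(-w) / ω⌋ ⌊w / ω⌋).card : ℝ) := by exact_mod_cast h1
      _ ≤ _ := by gcongr
  have hspR : (S.card : ℝ) ≤ (2 * N + 1) * ((S.image c).card : ℝ) + B.card := by
    rw [hB]
    exact_mod_cast hsp
  refine hspR.trans (add_le_add ?_ hBcard)
  gcongr

lemma card_le_of_unit_intervals {ι : Type*} (S : Finset ι) (u : ι → ℝ) {A W B : ℝ} (hW : 0 ≤ W)
    (hB : 0 ≤ B) (hu : ∀ x ∈ S, A ≤ u x ∧ u x ≤ A + W)
    (h : ∀ z : ℝ, ((S.filter (fun x => z ≤ u x ∧ u x < z + 1)).card : ℝ) ≤ B) :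
    (S.card : ℝ) ≤ (W + 1) * B := by
  have hmaps : ∀ x ∈ S, ⌊u x - A⌋ ∈ Finset.Icc (0 : ℤ) ⌊W⌋ := by
    intro x hx
    obtain ⟨h1, h2⟩ := hu x hx
    rw [Finset.mem_Icc]
    exact ⟨Int.floor_nonneg.2 (by linarith), Int.floor_le_floor (by linarith)⟩
  rw [Finset.card_eq_sum_card_fiberwise hmaps]
  push_cast
  calc ∑ b ∈ Finset.Icc (0 : ℤ) ⌊W⌋, ((S.filter (fun x => ⌊u x - A⌋ = b)).card : ℝ)
      ≤ ∑ b ∈ Finset.Icc (0 : ℤ) ⌊W⌋, B := by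
        refine Finset.sum_le_sum fun b _ => le_trans ?_ (h (A + b))
        refine Nat.cast_le.2 (Finset.card_le_card fun x hx => ?_)
        obtain ⟨hxS, hxb⟩ := Finset.mem_filter.1 hx
        obtain ⟨h1, h2⟩ := Int.floor_eq_iff.1 hxb
        exact Finset.mem_filter.2 ⟨hxS, by linarith, by linarith⟩
    _ = ((Finset.Icc (0 : ℤ) ⌊W⌋).card : ℝ) * B := by rw [Finset.sum_const, nsmul_eq_mul]
    _ ≤ (W + 1) * B := by
        gcongr
        have h0 : 0 ≤ ⌊W⌋ := Int.floor_nonneg.2 hW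
        rw [Int.card_Icc, sub_zero]
        have h1 : (((⌊W⌋ + 1).toNat : ℤ) : ℝ) = ⌊W⌋ + 1 := by
          rw [Int.toNat_of_nonneg (by omega)]; push_cast; ring
        rw [Int.cast_natCast] at h1
        rw [h1]
        linarith [Int.floor_le W]

lemma exists_pow_bracket_le {y Y : ℝ} {L : ℕ} (hy : 1 ≤ y) (hyY : y ≤ Y) (hY : Y < 16 ^ L) :
    ∃ j < L, Y / 16 ^ j / 16 < y ∧ y ≤ Y / 16 ^ j := by
  have hy0 : 0 < y := by linarith
  obtain ⟨j, h1, h2⟩ := exists_nat_pow_near (x := Y / y) (y := (16 : ℝ))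
    (by rw [le_div_iff₀ hy0]; linarith) (by norm_num)
  rw [le_div_iff₀ hy0] at h1
  rw [div_lt_iff₀ hy0] at h2
  refine ⟨j, ?_, ?_, ?_⟩
  · have : (16 : ℝ) ^ j < 16 ^ L := by
      have : (16 : ℝ) ^ j * 1 ≤ 16 ^ j * y := by gcongr
      linarith
    exact (pow_lt_pow_iff_right₀ (by norm_num)).1 this
  · rw [div_div, div_lt_iff₀ (by positivity)]
    rw [pow_succ] at h2
    linarith
  · rw [le_div_iff₀ (by positivity)]
    linarith

/-- Dyadic decomposition of a sum of reciprocals. -/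
lemma sum_inv_mul_le_dyadic {ι : Type*} (S : Finset ι) (y m : ι → ℝ) {Y ρ : ℝ} {L : ℕ}
    (hρ : 0 < ρ) (hYL : Y < 16 ^ L) (hy : ∀ x ∈ S, 1 ≤ y x ∧ y x ≤ Y) (hm : ∀ x ∈ S, ρ ≤ m x) :
    ∃ K : ℕ, ∑ x ∈ S, 1 / (y x * m x) ≤ ∑ j ∈ Finset.range L, ∑ k ∈ Finset.range K,
      16 / (Y / 16 ^ j * (16 ^ k * ρ)) * ((S.filter (fun x => (Y / 16 ^ j / 16 < y x ∧
        y x ≤ Y / 16 ^ j) ∧ (16 ^ k * ρ ≤ m x ∧ m x ≤ 16 ^ (k + 1) * ρ))).card : ℝ) := by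
  have h1 : ∀ x, ∃ j : ℕ, x ∈ S → j < L ∧ Y / 16 ^ j / 16 < y x ∧ y x ≤ Y / 16 ^ j := by
    intro x
    by_cases hx : x ∈ S
    · obtain ⟨j, h⟩ := exists_pow_bracket_le (hy x hx).1 (hy x hx).2 hYL
      exact ⟨j, fun _ => h⟩
    · exact ⟨0, fun h => absurd h hx⟩
  have h2 : ∀ x, ∃ k : ℕ, x ∈ S → 16 ^ k * ρ ≤ m x ∧ m x ≤ 16 ^ (k + 1) * ρ := by
    intro x
    by_cases hx : x ∈ S
    · obtain ⟨k, h3, h4⟩ := exists_nat_pow_near (x := m x / ρ) (y := (16 : ℝ))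
        (by rw [le_div_iff₀ hρ, one_mul]; exact hm x hx) (by norm_num)
      rw [le_div_iff₀ hρ] at h3
      rw [div_lt_iff₀ hρ] at h4
      exact ⟨k, fun _ => ⟨h3, h4.le⟩⟩
    · exact ⟨0, fun h => absurd h hx⟩
  choose j hj using h1
  choose k hk using h2
  refine ⟨S.sup k + 1, ?_⟩
  have hmaps : ∀ x ∈ S, (j x, k x) ∈ Finset.range L ×ˢ Finset.range (S.sup k + 1) := by
    intro x hx
    rw [Finset.mem_product, Finset.mem_range, Finset.mem_range]
    exact ⟨(hj x hx).1, Nat.lt_succ_of_le (Finset.le_sup hx)⟩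
  rw [← Finset.sum_fiberwise_of_maps_to hmaps, ← Finset.sum_product']
  refine Finset.sum_le_sum fun p _ => ?_
  have hle : ∀ x ∈ S.filter (fun x => (j x, k x) = p),
      1 / (y x * m x) ≤ 16 / (Y / 16 ^ p.1 * (16 ^ p.2 * ρ)) := by
    intro x hx
    obtain ⟨hxS, rfl⟩ := Finset.mem_filter.1 hx
    obtain ⟨-, h3, h4⟩ := hj x hxS
    obtain ⟨h5, h6⟩ := hk x hxS
    have hy1 := hy x hxS
    have hY : 0 < Y / 16 ^ j x := by linarith
    have hm1 : 0 < m x := hρ.trans_le (hm x hxS)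
    have hy0 : 0 < y x := by linarith
    rw [div_le_div_iff₀ (by positivity) (by positivity), one_mul, mul_comm (16 : ℝ)]
    calc Y / 16 ^ j x * (16 ^ k x * ρ) ≤ (y x * 16) * m x := by
          gcongr
          linarith
      _ = _ := by ring
  refine (Finset.sum_le_card_nsmul _ _ _ hle).trans ?_
  rw [nsmul_eq_mul, mul_comm]
  rcases (S.filter (fun x => (j x, k x) = p)).eq_empty_or_nonempty with he | ⟨x, hx⟩
  · rw [he, Finset.card_empty, Nat.cast_zero, mul_zero]
    rcases S.eq_empty_or_nonempty with rfl | ⟨x, hx⟩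
    · simp
    · have := hy x hx
      have : 0 < Y := by linarith
      positivity
  · have hx' := hx
    obtain ⟨hxS, rfl⟩ := Finset.mem_filter.1 hx
    have := hy x hxS
    have : 0 < Y := by linarith
    refine mul_le_mul_of_nonneg_left (Nat.cast_le.2 (Finset.card_le_card ?_)) (by positivity)
    intro x' hx'
    obtain ⟨hS', he⟩ := Finset.mem_filter.1 hx'
    have e1 : j x' = j x := congrArg Prod.fst he
    have e2 : k x' = k x := congrArg Prod.snd he
    have h3 := (hj x' hS').2
    have h4 := hk x' hS'
    rw [e1] at h3
    rw [e2] at h4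
    exact Finset.mem_filter.2 ⟨hS', h3, h4⟩

lemma sum_pow_capped_le (n : ℕ) {a x B : ℝ} (ha : 0 ≤ a) (hx : 2 ≤ x) (hB : 0 ≤ B) :
    ∑ k ∈ (Finset.range n).filter (fun k => a * x ^ k ≤ B), a * x ^ k ≤ 2 * B := by
  have hx0 : 0 < x := by linarith
  have key : ∀ m : ℕ, ∑ k ∈ Finset.range m, a * x ^ k ≤ a * x ^ m := by
    intro m
    induction m with
    | zero => simpa using ha
    | succ m ih =>
      rw [Finset.sum_range_succ, pow_succ]
      have : 0 ≤ a * x ^ m := by positivity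
      nlinarith
  rcases ((Finset.range n).filter (fun k => a * x ^ k ≤ B)).eq_empty_or_nonempty with he | hne
  · rw [he]; simpa using hB
  set G := (Finset.range n).filter (fun k => a * x ^ k ≤ B) with hG
  obtain ⟨m, hm, hmax⟩ := G.exists_max_image id hne
  have hsub : G ⊆ Finset.range (m + 1) := fun k hk =>
    Finset.mem_range.2 (Nat.lt_succ_of_le (hmax k hk))
  have hmB := (Finset.mem_filter.1 hm).2
  calc ∑ k ∈ G, a * x ^ k ≤ ∑ k ∈ Finset.range (m + 1), a * x ^ k :=
        Finset.sum_le_sum_of_subset_of_nonneg hsub fun _ _ _ => by positivity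
    _ = ∑ k ∈ Finset.range m, a * x ^ k + a * x ^ m := Finset.sum_range_succ _ _
    _ ≤ 2 * B := by linarith [key m]

lemma sum_inv_pow_le (n : ℕ) {x : ℝ} (hx : 2 ≤ x) :
    ∑ k ∈ Finset.range n, 1 / x ^ k ≤ 2 := by
  have hx0 : 0 < x := by linarith
  have key : ∑ k ∈ Finset.range n, 1 / x ^ k ≤ 2 - 2 * (1 / x ^ n) := by
    induction n with
    | zero => norm_num
    | succ m ih =>
      rw [Finset.sum_range_succ, pow_succ]
      have h1 : 1 / (x ^ m * x) ≤ (1 / x ^ m) * (1 / 2) := by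
        rw [one_div_mul_one_div]
        exact one_div_le_one_div_of_le (by positivity) (by gcongr)
      linarith
  have : 0 < 1 / x ^ n := by positivity
  linarith

lemma sum_inv_pow_capped_le (n : ℕ) {a x B : ℝ} (ha : 0 ≤ a) (hx : 2 ≤ x) (hB : 0 ≤ B) :
    ∑ j ∈ (Finset.range n).filter (fun j => a / x ^ j ≤ B), a / x ^ j ≤ 2 * B := by
  have hx0 : 0 < x := by linarith
  rcases ((Finset.range n).filter (fun j => a / x ^ j ≤ B)).eq_empty_or_nonempty with he | hne
  · rw [he]; simpa using hB
  set G := (Finset.range n).filter (fun j => a / x ^ j ≤ B) with hG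
  obtain ⟨m, hm, hmin⟩ := G.exists_min_image id hne
  obtain ⟨hmn, hmB⟩ := Finset.mem_filter.1 hm
  have hsub : G ⊆ Finset.Ico m n := fun k hk =>
    Finset.mem_Ico.2 ⟨hmin k hk, Finset.mem_range.1 (Finset.mem_filter.1 hk).1⟩
  calc ∑ j ∈ G, a / x ^ j ≤ ∑ j ∈ Finset.Ico m n, a / x ^ j :=
        Finset.sum_le_sum_of_subset_of_nonneg hsub fun _ _ _ => by positivity
    _ = ∑ i ∈ Finset.range (n - m), (a / x ^ m) * (1 / x ^ i) := by
        rw [Finset.sum_Ico_eq_sum_range]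
        refine Finset.sum_congr rfl fun i _ => ?_
        rw [pow_add]
        field_simp
    _ = (a / x ^ m) * ∑ i ∈ Finset.range (n - m), 1 / x ^ i := by rw [Finset.mul_sum]
    _ ≤ B * 2 := by
        gcongr
        exact sum_inv_pow_le _ hx
    _ = 2 * B := by ring

/-- A sum over powers of `x` of the minimum of an increasing and a decreasing sequence. -/
lemma sum_min_sq_div_le (n : ℕ) {x T : ℝ} (hx : 2 ≤ x) (hT : 0 < T) :
    ∑ k ∈ Finset.range n, (min (x ^ k) T) ^ 2 / x ^ k ≤ 4 * T := by
  have hx0 : 0 < x := by linarith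
  rw [← Finset.sum_filter_add_sum_filter_not (Finset.range n) (fun k => 1 * x ^ k ≤ T)]
  have h1 : ∑ k ∈ (Finset.range n).filter (fun k => 1 * x ^ k ≤ T),
      (min (x ^ k) T) ^ 2 / x ^ k ≤ 2 * T := by
    refine le_trans (Finset.sum_le_sum fun k hk => ?_)
      (sum_pow_capped_le n (a := 1) (by norm_num) hx hT.le)
    have hk2 := (Finset.mem_filter.1 hk).2
    rw [one_mul] at hk2 ⊢
    rw [min_eq_left hk2, pow_two, mul_div_assoc, div_self (by positivity), mul_one]
  have h2 : ∑ k ∈ (Finset.range n).filter (fun k => ¬ 1 * x ^ k ≤ T),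
      (min (x ^ k) T) ^ 2 / x ^ k ≤ 2 * T := by
    refine le_trans ?_ (sum_inv_pow_capped_le n (a := T ^ 2) (by positivity) hx hT.le)
    refine (Finset.sum_le_sum (g := fun k => T ^ 2 / x ^ k) fun k hk => ?_).trans
      (Finset.sum_le_sum_of_subset_of_nonneg ?_ fun _ _ _ => by positivity)
    · gcongr
      exact min_le_right _ _
    · intro k hk
      obtain ⟨hk1, hk2⟩ := Finset.mem_filter.1 hk
      rw [one_mul] at hk2
      push Not at hk2
      refine Finset.mem_filter.2 ⟨hk1, ?_⟩
      rw [div_le_iff₀ (by positivity)]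
      nlinarith
  linarith

lemma card_int_near_le (S : Finset ℤ) {a ω s : ℝ} (hω : 0 < ω) (hs : 0 ≤ s)
    (h : ∀ i ∈ S, |a - i * ω| ≤ s) : (S.card : ℝ) ≤ 2 * (s / ω) + 2 := by
  have hsub : S ⊆ Finset.Icc ⌊(a - s) / ω⌋ ⌊(a + s) / ω⌋ := by
    intro i hi
    have h1 := abs_le.1 (h i hi)
    rw [Finset.mem_Icc]
    refine ⟨?_, Int.le_floor.2 ((le_div_iff₀ hω).2 (by linarith))⟩
    have h2 : (⌊(a - s) / ω⌋ : ℝ) ≤ i :=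
      (Int.floor_le _).trans ((div_le_iff₀ hω).2 (by linarith))
    exact_mod_cast h2
  have h1 := card_Icc_floor_le ((a - s) / ω) ((a + s) / ω) (by gcongr; linarith)
  have e : (a + s) / ω - (a - s) / ω + 2 = 2 * (s / ω) + 2 := by ring
  rw [e] at h1
  exact (Nat.cast_le.2 (Finset.card_le_card hsub)).trans h1

lemma card_le_mul_card_image_fst {α β : Type*} [DecidableEq α] [DecidableEq β]
    (E : Finset (α × β)) {I : ℝ}
    (h : ∀ a, (((E.filter (fun p => p.1 = a)).image Prod.snd).card : ℝ) ≤ I) :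
    (E.card : ℝ) ≤ I * ((E.image Prod.fst).card : ℝ) := by
  rw [Finset.card_eq_sum_card_image Prod.fst E]
  push_cast
  rw [mul_comm, ← nsmul_eq_mul]
  refine Finset.sum_le_card_nsmul _ _ _ fun a _ => le_trans ?_ (h a)
  rw [Finset.card_image_of_injOn]
  intro p hp p' hp' he
  have h1 := (Finset.mem_filter.1 hp).2
  have h2 := (Finset.mem_filter.1 hp').2
  exact Prod.ext (h1.trans h2.symm) he

/-- The number of dual points in a dyadic class, in terms of a bound for points near the dual
curve. -/
lemma card_dyadic_class_le {C : ℝ} {h g hd gd : ℝ → ℝ} (D : LegendrePair C h g hd gd)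
    {X r z θ T ω : ℝ} (hX : 0 < X) (hθ : 0 < θ) (hT : 1 ≤ T) (ht : θ * T = r * X)
    (hω : ω = (θ / (2 * C * X)) ^ 2) {Y B : ℝ} (k : ℕ)
    (hdual : ∀ (z' : ℝ) (S' : Finset (ℤ × ℤ × ℤ)),
      NearPoints hd Y ((9 * θ * max (16 ^ k) T / X) ^ 2) z' S' → (S'.card : ℝ) ≤ B)
    {E : Finset ((ℤ × ℤ × ℤ) × ℤ)}
    (hE : ∀ p ∈ E, IsUnimodular p.1 ∧ 0 < p.1.2.1 ∧ (p.1.2.1 : ℝ) ≤ Y ∧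
      |(p.2 : ℝ)| * ω ≤ r ^ 2 + ω ∧ |absc p.1 - g z| ≤ 4 * C ^ 2 ∧
      thick hd ω p ≤ 16 ^ (k + 1) * (θ / (2 * C * X))) :
    (E.card : ℝ) ≤ (514 * C ^ 2 * (min (16 ^ k) T) ^ 2) * (9 * C ^ 2 * B) := by
  have hC := D.one_le
  have hC0 : 0 < C := by linarith
  have hω0 : 0 < ω := by rw [hω]; positivity
  have hB : 0 ≤ B := by
    have := hdual 0 ∅ (by intro P hP; simp at hP)
    simpa using this
  have hrω : r ^ 2 = 4 * C ^ 2 * T ^ 2 * ω := by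
    have : r = θ * T / X := by rw [ht]; field_simp
    rw [this, hω]; field_simp; ring
  have h16 : (1 : ℝ) ≤ 16 ^ k := one_le_pow₀ (by norm_num)
  have hC2 : 1 ≤ C ^ 2 := one_le_pow₀ hC
  have hT2 : 1 ≤ T ^ 2 := one_le_pow₀ hT
  have hdist : ∀ p ∈ E, |hd (absc p.1) - p.2 * ω - ordi p.1| ≤ 256 * (16 ^ k) ^ 2 * ω := by
    intro p hp
    obtain ⟨-, -, -, -, -, h1⟩ := hE p hp
    have h2 : (thick hd ω p) ^ 2 = max |hd (absc p.1) - p.2 * ω - ordi p.1| ω :=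
      Real.sq_sqrt (le_max_of_le_right hω0.le)
    have h3 : (thick hd ω p) ^ 2 ≤ (16 ^ (k + 1) * (θ / (2 * C * X))) ^ 2 :=
      pow_le_pow_left₀ (Real.sqrt_nonneg _) h1 2
    rw [h2] at h3
    refine ((le_max_left _ _).trans h3).trans (le_of_eq ?_)
    rw [hω, pow_succ]
    ring
  refine (card_le_mul_card_image_fst E (I := 514 * C ^ 2 * (min (16 ^ k) T) ^ 2) ?_).trans ?_
  · intro Λ
    rcases le_total (16 ^ k : ℝ) T with hk | hk
    · rw [min_eq_left hk]
      refine (card_int_near_le _ (a := hd (absc Λ) - ordi Λ) hω0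
        (s := 256 * (16 ^ k) ^ 2 * ω) (by positivity) ?_).trans ?_
      · intro i hi
        obtain ⟨p, hp, rfl⟩ := Finset.mem_image.1 hi
        obtain ⟨hpE, rfl⟩ := Finset.mem_filter.1 hp
        have := hdist p hpE
        rwa [sub_right_comm] at this
      · rw [mul_div_assoc, div_self hω0.ne']
        have : (1 : ℝ) ≤ (16 ^ k) ^ 2 := one_le_pow₀ h16
        nlinarith
    · rw [min_eq_right hk]
      refine (card_int_near_le _ (a := 0) hω0
        (s := r ^ 2 + ω) (by positivity) ?_).trans ?_
      · intro i hi
        obtain ⟨p, hp, rfl⟩ := Finset.mem_image.1 hi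
        obtain ⟨hpE, rfl⟩ := Finset.mem_filter.1 hp
        rw [zero_sub, abs_neg, abs_mul, abs_of_pos hω0]
        exact (hE p hpE).2.2.2.1
      · rw [hrω, add_div, mul_div_assoc, div_self hω0.ne']
        nlinarith
  · gcongr
    refine (card_le_of_unit_intervals (E.image Prod.fst) absc (A := g z - 4 * C ^ 2)
      (W := 8 * C ^ 2) (B := B) (by positivity) hB ?_ ?_).trans ?_
    · intro Λ hΛ
      obtain ⟨p, hp, rfl⟩ := Finset.mem_image.1 hΛ
      have := abs_le.1 (hE p hp).2.2.2.2.1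
      constructor <;> linarith
    · intro z'
      refine hdual z' _ ?_
      intro Λ hΛ
      obtain ⟨hΛ1, hΛ2⟩ := Finset.mem_filter.1 hΛ
      obtain ⟨p, hp, rfl⟩ := Finset.mem_image.1 hΛ1
      obtain ⟨h1, h2, h3, h4, -⟩ := hE p hp
      refine ⟨h1, ⟨h2, h3⟩, hΛ2, ?_⟩
      have h5 := hdist p hp
      have h6 : |hd (absc p.1) - ordi p.1|
          ≤ |hd (absc p.1) - p.2 * ω - ordi p.1| + |(p.2 : ℝ)| * ω := by
        calc |hd (absc p.1) - ordi p.1|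
            = |(hd (absc p.1) - p.2 * ω - ordi p.1) + p.2 * ω| := by congr 1; ring
          _ ≤ _ := by
            refine (abs_add_le _ _).trans (le_of_eq ?_)
            rw [abs_mul, abs_of_pos hω0]
      have h7 : (9 * θ * max (16 ^ k) T / X) ^ 2 = 324 * C ^ 2 * (max (16 ^ k) T) ^ 2 * ω := by
        rw [hω]; field_simp; ring
      rw [h7]
      have hM1 : (16 ^ k : ℝ) ≤ max (16 ^ k) T := le_max_left _ _
      have hM2 : T ≤ max (16 ^ k) T := le_max_right _ _
      set M := max (16 ^ k) T with hM
      have h8 : (16 ^ k : ℝ) ^ 2 ≤ M ^ 2 := by gcongr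
      have h9 : T ^ 2 ≤ M ^ 2 := by gcongr
      have h10 : M ^ 2 ≤ C ^ 2 * M ^ 2 := le_mul_of_one_le_left (by positivity) hC2
      have h11 : C ^ 2 * T ^ 2 ≤ C ^ 2 * M ^ 2 := by gcongr
      have : 256 * (16 ^ k) ^ 2 * ω + (4 * C ^ 2 * T ^ 2 * ω + ω)
          ≤ 324 * C ^ 2 * M ^ 2 * ω := by
        have : 256 * (16 ^ k) ^ 2 + 4 * (C ^ 2 * T ^ 2) + 1 ≤ 324 * (C ^ 2 * M ^ 2) := by
          linarith
        calc _ = (256 * (16 ^ k) ^ 2 + 4 * (C ^ 2 * T ^ 2) + 1) * ω := by ring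
          _ ≤ (324 * (C ^ 2 * M ^ 2)) * ω := by gcongr
          _ = _ := by ring
      rw [hrω] at h4
      linarith
    · gcongr
      linarith

/-- A bound for points near the dual curve gives a bound for points near the curve. -/
lemma card_le_of_dual_bound {C : ℝ} {h g hd gd : ℝ → ℝ} (D : LegendrePair C h g hd gd)
    {X r z θ T : ℝ} (hX : 1 ≤ X) (hr : 0 < r) (hθ : 0 < θ) (hθ1 : θ ≤ 1) (hT : 1 ≤ T)
    (ht : θ * T = r * X) {N : ℕ} (hN : 1 ≤ N) {L : ℕ} (hL : X / N < 16 ^ L) (Ψ : ℝ → ℝ)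
    (hdual : ∀ (z' r' Y : ℝ) (S' : Finset (ℤ × ℤ × ℤ)), 0 < r' → 0 < Y → Y ≤ X / N →
      NearPoints hd Y (r' ^ 2) z' S' → (S'.card : ℝ) ≤ Y * Ψ (r' * Y))
    {S : Finset (ℤ × ℤ × ℤ)} (hS : NearPoints h X (r ^ 2) z S) :
    ∃ K : ℕ, (S.card : ℝ) ≤ 120 * N * C ^ 3 * X * T ^ 2 + 296064 * C ^ 5 * X *
      ∑ j ∈ Finset.range L, ∑ k ∈ (Finset.range K).filter
        (fun k => (1 / N : ℝ) / 16 ^ j * 16 ^ k ≤ 16 * C / N * θ),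
        θ * ((min (16 ^ k) T) ^ 2 / 16 ^ k) *
          Ψ (9 * (θ * max (16 ^ k) T * ((1 / N : ℝ) / 16 ^ j))) := by
  have hC := D.one_le
  have hC0 : 0 < C := by linarith
  have hX0 : 0 < X := by linarith
  have hN0 : (0 : ℝ) < N := by exact_mod_cast hN
  have hNR : (1 : ℝ) ≤ N := by exact_mod_cast hN
  set ρ : ℝ := θ / (2 * C * X) with hρ
  have hρ0 : 0 < ρ := by positivity
  set ω : ℝ := ρ ^ 2 with hω
  have hω0 : 0 < ω := by positivity
  have hωX : 4 * C ^ 2 * (ω * X ^ 2) = θ ^ 2 := by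
    rw [hω, hρ]; field_simp; ring
  have hθ2 : θ ^ 2 ≤ 1 := pow_le_one₀ hθ.le hθ1
  obtain ⟨E, hE, hcard⟩ := card_le_cells_add_lines D (z := z) (w := r ^ 2) hX (by positivity) hω0
    (hωX.le.trans hθ2) N hN hS
  have hrω : r ^ 2 / ω = 4 * C ^ 2 * T ^ 2 := by
    have : r = θ * T / X := by rw [ht]; field_simp
    rw [this, hω, hρ]; field_simp; ring
  have hT2 : 1 ≤ T ^ 2 := one_le_pow₀ hT
  have hC2 : 1 ≤ C ^ 2 := one_le_pow₀ hC
  have hthick : ∀ p, ρ ≤ thick hd ω p := by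
    intro p
    exact Real.le_sqrt_of_sq_le (le_max_right _ _)
  have hcells : (2 * N + 1) * ((2 * C * X + 2) * (2 * (r ^ 2 / ω) + 2))
      ≤ 120 * N * C ^ 3 * X * T ^ 2 := by
    rw [hrω]
    have h1 : 1 ≤ C ^ 2 * T ^ 2 := one_le_mul_of_one_le_of_one_le hC2 hT2
    have h2 : 1 ≤ C * X := one_le_mul_of_one_le_of_one_le hC hX
    calc (2 * N + 1) * ((2 * C * X + 2) * (2 * (4 * C ^ 2 * T ^ 2) + 2))
        ≤ (3 * N) * ((4 * (C * X)) * (10 * (C ^ 2 * T ^ 2))) := by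
          gcongr <;> linarith
      _ = _ := by ring
  obtain ⟨K, hK⟩ := sum_inv_mul_le_dyadic E (fun p => (p.1.2.1 : ℝ)) (thick hd ω) (Y := X / N)
    hρ0 hL (fun p hp => ⟨by exact_mod_cast (hE p hp).2.1, by
      rw [le_div_iff₀ hN0, mul_comm]; exact (hE p hp).2.2.1⟩) (fun p _ => hthick p)
  refine ⟨K, hcard.trans (add_le_add hcells ?_)⟩
  have hsum : ∑ p ∈ E, 4 * (2 * C ^ 2 * ω * X ^ 2) / (p.1.2.1 * thick hd ω p)
      = 2 * θ ^ 2 * ∑ p ∈ E, 1 / (p.1.2.1 * thick hd ω p) := by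
    rw [Finset.mul_sum]
    refine Finset.sum_congr rfl fun p _ => ?_
    rw [← hωX]
    ring
  rw [hsum]
  refine (mul_le_mul_of_nonneg_left hK (by positivity)).trans ?_
  rw [Finset.mul_sum, Finset.mul_sum]
  refine Finset.sum_le_sum fun j _ => ?_
  rw [Finset.mul_sum, Finset.mul_sum, Finset.sum_filter]
  refine Finset.sum_le_sum fun k _ => ?_
  set Y : ℝ := X / N / 16 ^ j with hY
  have hY0 : 0 < Y := by positivity
  set E' := E.filter (fun p => (Y / 16 < (p.1.2.1 : ℝ) ∧ (p.1.2.1 : ℝ) ≤ Y) ∧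
    (16 ^ k * ρ ≤ thick hd ω p ∧ thick hd ω p ≤ 16 ^ (k + 1) * ρ)) with hE'
  split_ifs with hjk
  · have hmax0 : 0 < max (16 ^ k : ℝ) T := lt_max_of_lt_right (by linarith)
    have hcl := card_dyadic_class_le D (E := E') (z := z) (Y := Y)
      (B := Y * Ψ (9 * θ * max (16 ^ k) T / X * Y)) hX0 hθ hT ht hω k
      (fun z' S' hS' => hdual z' _ Y S' (by positivity) hY0
        (div_le_self (by positivity) (one_le_pow₀ (by norm_num))) hS')
      (fun p hp => by
        obtain ⟨hpE, ⟨-, h1⟩, -, h2⟩ := Finset.mem_filter.1 hp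
        obtain ⟨h3, h4, -, -, h5, h6⟩ := hE p hpE
        exact ⟨h3, h4, h1, h5, h6, h2⟩)
    have e1 : 9 * θ * max (16 ^ k) T / X * Y
        = 9 * (θ * max (16 ^ k) T * ((1 / N : ℝ) / 16 ^ j)) := by
      rw [hY]; field_simp
    rw [e1] at hcl
    have e2 : 2 * θ ^ 2 * (16 / (Y * (16 ^ k * ρ))) = 64 * C * θ * X / (16 ^ k * Y) := by
      rw [hρ]; field_simp; ring
    rw [← mul_assoc, e2]
    refine (mul_le_mul_of_nonneg_left hcl (by positivity)).trans (le_of_eq ?_)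
    field_simp
    ring
  · have : E' = ∅ := by
      rw [Finset.eq_empty_iff_forall_notMem]
      intro p hp
      obtain ⟨hpE, ⟨h0, -⟩, h1, -⟩ := Finset.mem_filter.1 hp
      obtain ⟨-, -, -, h2, -⟩ := hE p hpE
      apply hjk
      have h3 : N * (Y / 16 * (16 ^ k * ρ)) ≤ 2 * C ^ 2 * ω * X ^ 2 := by
        refine le_trans ?_ h2
        have : (0 : ℝ) < p.1.2.1 := lt_trans (by positivity) h0
        gcongr
      have h4 : 2 * C ^ 2 * ω * X ^ 2 = θ ^ 2 / 2 := by rw [← hωX]; ring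
      have h5 : N * (Y / 16 * (16 ^ k * ρ)) = θ * (1 / 16 ^ j * 16 ^ k) / (32 * C) := by
        rw [hY, hρ]; field_simp; ring
      rw [h4, h5, div_le_iff₀ (by positivity)] at h3
      have h6 : (1 / 16 ^ j * 16 ^ k : ℝ) ≤ 16 * C * θ := by
        refine le_of_mul_le_mul_left ?_ hθ
        calc _ ≤ _ := h3
          _ = _ := by ring
      calc (1 / N : ℝ) / 16 ^ j * 16 ^ k = (1 / 16 ^ j * 16 ^ k) / N := by field_simp
        _ ≤ (16 * C * θ) / N := by gcongr
        _ = _ := by ring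
    rw [this]
    simp

/-- The shape of the bound for the number of primitive rational points near a curve. -/
noncomputable def countBound (K₁ K₂ L s : ℝ) : ℝ := K₁ * (1 + s ^ 2) + K₂ * L * (s + s * √s)

lemma term_le {θ T x y τ κ K₁ K₂ L t : ℝ} (hθ : 0 < θ) (hθ1 : θ ≤ 1) (hT : 1 ≤ T)
    (ht : t = θ * T) (hy : 1 ≤ y) (hx : x = y ^ 2) (hτ : 0 < τ) (hκ : κ ≤ 1)
    (hτx : τ * x ≤ κ * θ) (hK₁ : 0 ≤ K₁) (hK₂ : 0 ≤ K₂) (hL : 0 ≤ L) :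
    θ * ((min x T) ^ 2 / x) * countBound K₁ K₂ L (9 * (θ * max x T * τ))
      ≤ K₁ * θ * ((min x T) ^ 2 / x) +
        (81 * K₁ * t ^ 2 + 36 * K₂ * L * (t * √t)) * (y * τ) := by
  have hy0 : 0 < y := by linarith
  have hx0 : 0 < x := by rw [hx]; positivity
  have hx1 : 1 ≤ x := by rw [hx]; exact one_le_pow₀ hy
  have ht0 : 0 < t := by rw [ht]; positivity
  have hτx1 : τ * x ≤ 1 := hτx.trans (mul_le_one₀ hκ hθ.le hθ1)
  have hm0 : 0 < min x T := lt_min hx0 (by linarith)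
  have hM0 : 0 < max x T := lt_max_of_lt_left hx0
  have hmM : min x T * max x T = x * T := min_mul_max x T
  have hm1 : min x T ≤ x := min_le_left _ _
  have hm2 : min x T ≤ T := min_le_right _ _
  set m := min x T
  set M := max x T
  have hsT : θ * √T ≤ √t := by
    rw [ht, Real.sqrt_mul hθ.le]
    gcongr
    refine Real.le_sqrt_of_sq_le ?_
    nlinarith
  have hst : √t * √t = t := Real.mul_self_sqrt ht0.le
  have h2 : θ * (m ^ 2 / x) * (9 * (θ * M * τ)) ^ 2 ≤ 81 * t ^ 2 * (y * τ) := by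
    have e : θ * (m ^ 2 / x) * (9 * (θ * M * τ)) ^ 2 = 81 * t ^ 2 * (θ * (τ * x) * τ) := by
      calc _ = 81 * θ ^ 3 * τ ^ 2 * (m * M) ^ 2 / x := by ring
        _ = _ := by rw [hmM, ht]; field_simp
    rw [e]
    have : θ * (τ * x) ≤ y := (mul_le_one₀ hθ1 (by positivity) hτx1).trans hy
    gcongr
  have hms : m ≤ √T * y := by
    refine abs_le_of_sq_le_sq' ?_ (by positivity) |>.2
    rw [mul_pow, Real.sq_sqrt (by linarith), ← hx, pow_two, mul_comm T]
    gcongr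
  have e3 : θ * (m ^ 2 / x) * (9 * (θ * M * τ)) = 9 * θ ^ 2 * T * τ * m := by
    calc _ = 9 * θ ^ 2 * τ * m * (m * M) / x := by ring
      _ = _ := by rw [hmM]; field_simp
  have h3 : θ * (m ^ 2 / x) * (9 * (θ * M * τ)) ≤ 9 * (t * √t) * (y * τ) := by
    rw [e3]
    calc 9 * θ ^ 2 * T * τ * m ≤ 9 * θ ^ 2 * T * τ * (√T * y) := by gcongr
      _ = 9 * (θ * T) * (θ * √T) * (y * τ) := by ring
      _ ≤ 9 * (θ * T) * √t * (y * τ) := by gcongr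
      _ = _ := by rw [ht]; ring
  have h4 : θ * (m ^ 2 / x) * (9 * (θ * M * τ) * √(9 * (θ * M * τ)))
      ≤ 27 * (t * √t) * (y * τ) := by
    have h5 : m * √(9 * (θ * M * τ)) ≤ 3 * (y * √t) := by
      refine abs_le_of_sq_le_sq' ?_ (by positivity) |>.2
      rw [mul_pow, Real.sq_sqrt (by positivity), mul_pow, mul_pow, Real.sq_sqrt ht0.le, ← hx]
      calc m ^ 2 * (9 * (θ * M * τ)) = 9 * θ * τ * m * (m * M) := by ring
        _ = 9 * (θ * T) * (τ * x) * m := by rw [hmM]; ring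
        _ ≤ 9 * (θ * T) * 1 * x := by gcongr
        _ = _ := by rw [ht]; ring
    calc _ = (θ * (m ^ 2 / x) * (9 * (θ * M * τ))) * √(9 * (θ * M * τ)) := by ring
      _ = 9 * θ ^ 2 * T * τ * (m * √(9 * (θ * M * τ))) := by rw [e3]; ring
      _ ≤ 9 * θ ^ 2 * T * τ * (3 * (y * √t)) := by gcongr
      _ = θ * (27 * (t * √t) * (y * τ)) := by rw [ht]; ring
      _ ≤ 1 * (27 * (t * √t) * (y * τ)) := by gcongr
      _ = _ := one_mul _
  simp only [countBound]
  calc _ = K₁ * θ * (m ^ 2 / x) + K₁ * (θ * (m ^ 2 / x) * (9 * (θ * M * τ)) ^ 2) + K₂ * L *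
      (θ * (m ^ 2 / x) * (9 * (θ * M * τ)) +
        θ * (m ^ 2 / x) * (9 * (θ * M * τ) * √(9 * (θ * M * τ)))) := by ring
    _ ≤ K₁ * θ * (m ^ 2 / x) + K₁ * (81 * t ^ 2 * (y * τ)) + K₂ * L *
      (9 * (t * √t) * (y * τ) + 27 * (t * √t) * (y * τ)) := by gcongr
    _ = _ := by ring

lemma sum_terms_le {L K : ℕ} {θ T t c κ K₁ K₂ : ℝ} (hθ : 0 < θ) (hθ1 : θ ≤ 1) (hT : 1 ≤ T)
    (ht : t = θ * T) (hc : 0 < c) (hκ0 : 0 ≤ κ) (hκ : κ ≤ 1) (hK₁ : 0 ≤ K₁) (hK₂ : 0 ≤ K₂) :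
    ∑ j ∈ Finset.range L, ∑ k ∈ (Finset.range K).filter
        (fun k => c / 16 ^ j * 16 ^ k ≤ κ * θ),
        θ * ((min (16 ^ k) T) ^ 2 / 16 ^ k) *
          countBound K₁ K₂ L (9 * (θ * max (16 ^ k) T * (c / 16 ^ j)))
      ≤ 4 * K₁ * L * t + (81 * K₁ * t ^ 2 + 36 * K₂ * L * (t * √t)) * (4 * κ) := by
  have ht0 : 0 < t := by rw [ht]; positivity
  have h1 : ∑ j ∈ Finset.range L, ∑ k ∈ (Finset.range K).filter
        (fun k => c / 16 ^ j * 16 ^ k ≤ κ * θ), K₁ * θ * ((min (16 ^ k) T) ^ 2 / 16 ^ k)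
      ≤ 4 * K₁ * L * t := by
    calc _ ≤ ∑ j ∈ Finset.range L, K₁ * θ * (4 * T) := by
          refine Finset.sum_le_sum fun j _ => ?_
          rw [← Finset.mul_sum]
          refine mul_le_mul_of_nonneg_left ?_ (by positivity)
          refine (Finset.sum_le_sum_of_subset_of_nonneg (Finset.filter_subset _ _)
            fun _ _ _ => by positivity).trans (sum_min_sq_div_le K (by norm_num) (by linarith))
      _ = _ := by rw [Finset.sum_const, Finset.card_range, nsmul_eq_mul, ht]; ring
  have h2 : ∑ j ∈ Finset.range L, ∑ k ∈ (Finset.range K).filter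
        (fun k => c / 16 ^ j * 16 ^ k ≤ κ * θ), ((4 : ℝ) ^ k * (c / 16 ^ j)) ≤ 4 * κ := by
    simp_rw [Finset.sum_filter]
    rw [Finset.sum_comm]
    calc _ ≤ ∑ k ∈ Finset.range K, 2 * κ * (1 / (4 : ℝ) ^ k) := by
          refine Finset.sum_le_sum fun k _ => ?_
          rw [← Finset.sum_filter, ← Finset.mul_sum]
          have h3 : ∑ j ∈ (Finset.range L).filter (fun j => c / 16 ^ j * 16 ^ k ≤ κ * θ),
              c / 16 ^ j ≤ 2 * (κ * θ / 16 ^ k) := by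
            have := sum_inv_pow_capped_le L (a := c) (x := 16) (B := κ * θ / 16 ^ k) hc.le
              (by norm_num) (by positivity)
            simp_rw [le_div_iff₀ (show (0 : ℝ) < 16 ^ k by positivity)] at this
            exact this
          calc (4 : ℝ) ^ k * ∑ j ∈ (Finset.range L).filter
                (fun j => c / 16 ^ j * 16 ^ k ≤ κ * θ), c / 16 ^ j
              ≤ 4 ^ k * (2 * (κ * θ / 16 ^ k)) := by gcongr
            _ ≤ 4 ^ k * (2 * (κ * 1 / 16 ^ k)) := by gcongr
            _ = _ := by
              rw [show (16 : ℝ) = 4 * 4 by norm_num, mul_pow]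
              field_simp
      _ = 2 * κ * ∑ k ∈ Finset.range K, 1 / (4 : ℝ) ^ k := by rw [Finset.mul_sum]
      _ ≤ 2 * κ * 2 := by
          gcongr
          exact sum_inv_pow_le K (by norm_num)
      _ = 4 * κ := by ring
  calc _ ≤ ∑ j ∈ Finset.range L, ∑ k ∈ (Finset.range K).filter
        (fun k => c / 16 ^ j * 16 ^ k ≤ κ * θ), (K₁ * θ * ((min (16 ^ k) T) ^ 2 / 16 ^ k) +
        (81 * K₁ * t ^ 2 + 36 * K₂ * L * (t * √t)) * (4 ^ k * (c / 16 ^ j))) := by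
        refine Finset.sum_le_sum fun j _ => Finset.sum_le_sum fun k hk => ?_
        refine term_le hθ hθ1 hT ht (one_le_pow₀ (by norm_num)) ?_ (by positivity) hκ
          (Finset.mem_filter.1 hk).2 hK₁ hK₂ (Nat.cast_nonneg _)
        rw [← pow_mul, mul_comm k 2, pow_mul]
        norm_num
    _ ≤ _ := by
        simp_rw [Finset.sum_add_distrib, ← Finset.mul_sum] at h1 h2 ⊢
        gcongr

lemma countBound_nonneg {K₁ K₂ L s : ℝ} (hK₁ : 0 ≤ K₁) (hK₂ : 0 ≤ K₂) (hL : 0 ≤ L)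
    (hs : 0 ≤ s) : 0 ≤ countBound K₁ K₂ L s := by
  unfold countBound
  positivity

lemma NearPoints.eq_empty {h : ℝ → ℝ} {X w z : ℝ} {S : Finset (ℤ × ℤ × ℤ)}
    (hS : NearPoints h X w z S) (hX : X < 1) : S = ∅ := by
  rw [Finset.eq_empty_iff_forall_notMem]
  intro P hP
  obtain ⟨-, ⟨h1, h2⟩, -⟩ := hS P hP
  have : (1 : ℝ) ≤ P.2.1 := by exact_mod_cast h1
  linarith

/-- The number of primitive rational points of height at most `X` near a curve, by induction on
scales and duality. -/
theorem card_nearPoints_le {C : ℝ} (hC : 1 ≤ C) :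
    ∃ K₁ K₂ : ℝ, 0 ≤ K₁ ∧ 0 ≤ K₂ ∧ ∀ L n : ℕ, n ≤ L → ∀ h g hd gd : ℝ → ℝ,
      LegendrePair C h g hd gd → ∀ z r X : ℝ, 0 < r → 0 < X → X < 16 ^ n →
      ∀ S : Finset (ℤ × ℤ × ℤ), NearPoints h X (r ^ 2) z S →
        (S.card : ℝ) ≤ X * countBound K₁ K₂ L (r * X) := by
  have hC0 : 0 < C := by linarith
  obtain ⟨N, hNbig⟩ := exists_nat_ge (648 * (16 * C) * (296064 * C ^ 5) + 16 + 16 * C)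
  have hN16 : (16 : ℝ) ≤ N := le_trans (by
    have : 0 ≤ 648 * (16 * C) * (296064 * C ^ 5) + 16 * C := by positivity
    linarith) hNbig
  have hN0 : (0 : ℝ) < N := by linarith
  have hN1 : 1 ≤ N := by
    have : (1 : ℝ) ≤ N := by linarith
    exact_mod_cast this
  set C₇ : ℝ := 296064 * C ^ 5 with hC₇
  have hC₇0 : 0 < C₇ := by positivity
  set κ : ℝ := 16 * C / N with hκ
  have hκ0 : 0 ≤ κ := by positivity
  have hκ1 : κ ≤ 1 := by
    rw [hκ, div_le_one hN0]
    have : 0 ≤ 648 * (16 * C) * C₇ := by positivity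
    linarith
  have hC₇κ : C₇ * (648 * κ) ≤ 1 := by
    rw [hκ, ← mul_div_assoc, ← mul_div_assoc, div_le_one hN0]
    have : 0 ≤ 16 * C := by positivity
    linarith
  set K₁ : ℝ := 240 * N * C ^ 3 with hK₁
  set K₂ : ℝ := 4 * C₇ * K₁ with hK₂
  have hK₁0 : 0 ≤ K₁ := by positivity
  have hK₂0 : 0 ≤ K₂ := by positivity
  refine ⟨K₁, K₂, hK₁0, hK₂0, fun L n => ?_⟩
  have htriv : ∀ {h : ℝ → ℝ} {z r X : ℝ} {S : Finset (ℤ × ℤ × ℤ)}, 0 < r → 0 < X → X < 1 →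
      NearPoints h X (r ^ 2) z S → (S.card : ℝ) ≤ X * countBound K₁ K₂ L (r * X) := by
    intro h z r X S hr hX hX1 hS
    rw [hS.eq_empty hX1, Finset.card_empty, Nat.cast_zero]
    exact mul_nonneg hX.le (countBound_nonneg hK₁0 hK₂0 (Nat.cast_nonneg _) (by positivity))
  induction n with
  | zero =>
    intro _ h g hd gd _ z r X hr hX hX1 S hS
    exact htriv hr hX (by simpa using hX1) hS
  | succ n ih =>
    intro hnL h g hd gd D z r X hr hX hXn S hS
    rcases lt_or_ge X 1 with hX1 | hX1
    · exact htriv hr hX hX1 hS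
    have hXN : X / N < 16 ^ n := by
      rw [div_lt_iff₀ hN0]
      calc X < 16 ^ n * 16 := by rw [← pow_succ]; exact hXn
        _ ≤ 16 ^ n * N := by gcongr
    set t := r * X with ht
    have ht0 : 0 < t := by positivity
    set θ := min t 1
    set T := max t 1 with hT
    have hθ0 : 0 < θ := lt_min ht0 one_pos
    have hθT : θ * T = t := by rw [min_mul_max, mul_one]
    have hT1 : 1 ≤ T := le_max_right _ _
    have hTt : T ^ 2 ≤ 1 + t ^ 2 := by
      rcases le_total t 1 with h1 | h1
      · rw [hT, max_eq_right h1]; nlinarith [sq_nonneg t]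
      · rw [hT, max_eq_left h1]; linarith
    obtain ⟨K, hK⟩ := card_le_of_dual_bound D hX1 hr hθ0 (min_le_right _ _) hT1 hθT hN1
      (hXN.trans_le (pow_le_pow_right₀ (by norm_num) (by omega : n ≤ L))) (countBound K₁ K₂ L)
      (fun z' r' Y S' hr' hY hYX hS' => ih (by omega) hd gd h g D.swap z' r' Y hr' hY
        (hYX.trans_lt hXN) S' hS') hS
    have hsum := sum_terms_le (L := L) (K := K) (c := 1 / N) hθ0 (min_le_right _ _) hT1 hθT.symm
      (by positivity) hκ0 hκ1 hK₁0 hK₂0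
    refine hK.trans ((add_le_add_right (mul_le_mul_of_nonneg_left hsum (by positivity)) _).trans ?_)
    have e1 : 120 * N * C ^ 3 * X * T ^ 2 ≤ X * (K₁ / 2 * (1 + t ^ 2)) := by
      calc _ = X * (K₁ / 2 * T ^ 2) := by rw [hK₁]; ring
        _ ≤ _ := by gcongr
    have e2 : C₇ * ((81 * K₁ * t ^ 2 + 36 * K₂ * L * (t * √t)) * (4 * κ))
        ≤ K₁ / 2 * t ^ 2 + K₂ * L * (t * √t) := by
      calc _ = (C₇ * (648 * κ)) * (K₁ / 2 * t ^ 2 + (2 / 9) * (K₂ * L * (t * √t))) := by ring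
        _ ≤ 1 * (K₁ / 2 * t ^ 2 + 1 * (K₂ * L * (t * √t))) := by
          gcongr
          norm_num
        _ = _ := by ring
    unfold countBound
    calc _ ≤ X * (K₁ / 2 * (1 + t ^ 2)) + X * (4 * C₇ * K₁ * L * t +
          C₇ * ((81 * K₁ * t ^ 2 + 36 * K₂ * L * (t * √t)) * (4 * κ))) := by
          refine add_le_add e1 (le_of_eq ?_)
          rw [hC₇]; ring
      _ ≤ X * (K₁ / 2 * (1 + t ^ 2)) + X * (K₂ * L * t +
          (K₁ / 2 * t ^ 2 + K₂ * L * (t * √t))) := by gcongr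
      _ ≤ X * (K₁ * (1 + t ^ 2) + K₂ * L * (t + t * √t)) := by
          rw [← mul_add]
          refine mul_le_mul_of_nonneg_left ?_ hX.le
          linarith

lemma sum_inv_sq_le (n : ℕ) : ∑ d ∈ Finset.Icc 1 n, 1 / (d : ℝ) ^ 2 ≤ 2 := by
  have key : ∑ d ∈ Finset.Icc 1 n, 1 / (d : ℝ) ^ 2 ≤ 2 - 1 / (n : ℝ) := by
    induction n with
    | zero => norm_num
    | succ m ih =>
      rw [Finset.sum_Icc_succ_top (by omega)]
      rcases Nat.eq_zero_or_pos m with rfl | hm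
      · norm_num
      · have hmR : (0 : ℝ) < m := by exact_mod_cast hm
        have : 1 / ((m + 1 : ℕ) : ℝ) ^ 2 ≤ 1 / m - 1 / ((m + 1 : ℕ) : ℝ) := by
          push_cast
          rw [div_sub_div _ _ hmR.ne' (by positivity),
            div_le_div_iff₀ (by positivity) (by positivity)]
          nlinarith
        linarith
  have : 0 ≤ 1 / (n : ℝ) := by positivity
  linarith

/-- The number of all integer triples `(a, q, b)` with `q ≤ Q` and `(a / q, b / q)` near a
curve. -/
theorem card_near_triples_le {C : ℝ} (hC : 1 ≤ C) :
    ∃ K : ℝ, 0 ≤ K ∧ ∀ (L : ℕ) (h g hd gd : ℝ → ℝ), LegendrePair C h g hd gd →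
      ∀ z r Q : ℝ, 0 < r → 0 < Q → Q < 16 ^ L → ∀ S : Finset (ℤ × ℤ × ℤ),
      (∀ P ∈ S, (0 < P.2.1 ∧ (P.2.1 : ℝ) ≤ Q) ∧ (z ≤ absc P ∧ absc P < z + 1) ∧
        |h (absc P) - ordi P| ≤ r ^ 2) →
        (S.card : ℝ) ≤ Q * (K * (L * (1 + r * Q * √(r * Q)) + (r * Q) ^ 2)) := by
  obtain ⟨K₁, K₂, hK₁, hK₂, hmain⟩ := card_nearPoints_le hC
  refine ⟨4 * K₁ + 4 * K₂, by positivity, fun L h g hd gd D z r Q hr hQ hQL S hS => ?_⟩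
  set t := r * Q with ht
  have ht0 : 0 < t := by positivity
  rcases lt_or_ge Q 1 with hQ1 | hQ1
  · have : S = ∅ := by
      rw [Finset.eq_empty_iff_forall_notMem]
      intro P hP
      obtain ⟨⟨h1, h2⟩, -⟩ := hS P hP
      have : (1 : ℝ) ≤ P.2.1 := by exact_mod_cast h1
      linarith
    rw [this, Finset.card_empty, Nat.cast_zero]
    positivity
  have hL1 : (1 : ℝ) ≤ L := by
    have : L ≠ 0 := by
      rintro rfl
      rw [pow_zero] at hQL
      linarith
    exact_mod_cast Nat.one_le_iff_ne_zero.2 this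
  have hex : ∀ P : ℤ × ℤ × ℤ, ∃ dP : ℕ × (ℤ × ℤ × ℤ), P ∈ S → 0 < dP.1 ∧ 0 < dP.2.2.1 ∧
      P = (dP.1 * dP.2.1, dP.1 * dP.2.2.1, dP.1 * dP.2.2.2) ∧ IsUnimodular dP.2 := by
    intro P
    by_cases hP : P ∈ S
    · obtain ⟨d, a', q', b', hd, hq', ha, hq, hb, hU⟩ :=
        exists_unimodular_smul P.1 P.2.1 P.2.2 (hS P hP).1.1
      lift d to ℕ using hd.le
      exact ⟨(d, (a', q', b')), fun _ => ⟨by exact_mod_cast hd, hq',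
        Prod.ext ha (Prod.ext hq hb), hU⟩⟩
    · exact ⟨(0, (0, 0, 0)), fun h => absurd h hP⟩
  choose φ hφ using hex
  have hcoord : ∀ P ∈ S, (0 : ℝ) < (φ P).1 ∧ (0 : ℝ) < (φ P).2.2.1 ∧
      (P.2.1 : ℝ) = (φ P).1 * (φ P).2.2.1 ∧ absc (φ P).2 = absc P ∧ ordi (φ P).2 = ordi P := by
    intro P hP
    obtain ⟨h1, h2, h3, -⟩ := hφ P hP
    have h1R : (0 : ℝ) < (φ P).1 := by exact_mod_cast h1
    have h2R : (0 : ℝ) < (φ P).2.2.1 := by exact_mod_cast h2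
    have e1 : (P.1 : ℝ) = (φ P).1 * (φ P).2.1 := by
      have := congrArg Prod.fst h3
      simp only at this
      exact_mod_cast this
    have e2 : (P.2.1 : ℝ) = (φ P).1 * (φ P).2.2.1 := by
      have := congrArg (fun x => x.2.1) h3
      simp only at this
      exact_mod_cast this
    have e3 : (P.2.2 : ℝ) = (φ P).1 * (φ P).2.2.2 := by
      have := congrArg (fun x => x.2.2) h3
      simp only at this
      exact_mod_cast this
    refine ⟨h1R, h2R, e2, ?_, ?_⟩
    · simp only [absc]
      rw [e1, e2, mul_div_mul_left _ _ h1R.ne']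
    · simp only [ordi]
      rw [e3, e2, mul_div_mul_left _ _ h1R.ne']
  have hmaps : ∀ P ∈ S, (φ P).1 ∈ Finset.Icc 1 ⌊Q⌋₊ := by
    intro P hP
    obtain ⟨h1, h2, h3, -⟩ := hcoord P hP
    have h4 : (1 : ℝ) ≤ (φ P).2.2.1 := by exact_mod_cast (hφ P hP).2.1
    rw [Finset.mem_Icc]
    refine ⟨(hφ P hP).1, Nat.le_floor ?_⟩
    have := (hS P hP).1.2
    rw [h3] at this
    nlinarith
  have hfib : ∀ d ∈ Finset.Icc 1 ⌊Q⌋₊, ((S.filter (fun P => (φ P).1 = d)).card : ℝ)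
      ≤ Q * K₁ * (1 / d) + Q * (K₁ * t ^ 2 + K₂ * L * (t + t * √t)) * (1 / (d : ℝ) ^ 2) := by
    intro d hdm
    have hd1 : 1 ≤ d := (Finset.mem_Icc.1 hdm).1
    have hdR : (1 : ℝ) ≤ d := by exact_mod_cast hd1
    have hd0 : (0 : ℝ) < d := by linarith
    have hinj : Set.InjOn (fun P => (φ P).2) (S.filter (fun P => (φ P).1 = d)) := by
      intro P hP P' hP' he
      obtain ⟨hPS, hPd⟩ := Finset.mem_filter.1 hP
      obtain ⟨hPS', hPd'⟩ := Finset.mem_filter.1 hP'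
      rw [(hφ P hPS).2.2.1, (hφ P' hPS').2.2.1, hPd, hPd']
      simp only at he
      rw [he]
    rw [← Finset.card_image_of_injOn hinj]
    refine (hmain L L le_rfl h g hd gd D z r (Q / d) hr (by positivity)
      ((div_le_self hQ.le hdR).trans_lt hQL) _ ?_).trans ?_
    · intro P' hP'
      obtain ⟨P, hP, rfl⟩ := Finset.mem_image.1 hP'
      obtain ⟨hPS, hPd⟩ := Finset.mem_filter.1 hP
      obtain ⟨h1, h2, h3, h4, h5⟩ := hcoord P hPS
      obtain ⟨h6, h7, h8⟩ := hS P hPS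
      refine ⟨(hφ P hPS).2.2.2, ⟨(hφ P hPS).2.1, ?_⟩, ?_, ?_⟩
      · rw [le_div_iff₀ hd0, mul_comm]
        rw [h3, hPd] at h6
        exact h6.2
      · rw [h4]; exact h7
      · rw [h4, h5]; exact h8
    · have e1 : r * (Q / d) = t / d := by rw [ht]; ring
      rw [e1]
      have h1 : √(t / d) ≤ √t := Real.sqrt_le_sqrt (div_le_self ht0.le hdR)
      have h2 : t ^ 2 / d ≤ t ^ 2 := div_le_self (by positivity) hdR
      unfold countBound
      calc _ = Q * K₁ * (1 / d) + Q * (K₁ * (t ^ 2 / d) + K₂ * L * (t + t * √(t / d)))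
            * (1 / (d : ℝ) ^ 2) := by
            field_simp
            ring
        _ ≤ _ := by gcongr
  rw [Finset.card_eq_sum_card_fiberwise hmaps]
  push_cast
  refine (Finset.sum_le_sum hfib).trans ?_
  rw [Finset.sum_add_distrib, ← Finset.mul_sum, ← Finset.mul_sum]
  have hharm : ∑ d ∈ Finset.Icc 1 ⌊Q⌋₊, 1 / (d : ℝ) ≤ 4 * L := by
    have h1 := harmonic_le_one_add_log ⌊Q⌋₊
    rw [harmonic_eq_sum_Icc] at h1
    push_cast at h1
    simp_rw [← one_div] at h1
    refine h1.trans ?_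
    have h2 : Real.log ⌊Q⌋₊ ≤ Real.log (16 ^ L) := by
      refine Real.log_le_log ?_ ((Nat.floor_le hQ.le).trans hQL.le)
      exact_mod_cast Nat.floor_pos.2 hQ1
    have h3 : Real.log 16 ≤ 3 := by
      rw [show (16 : ℝ) = 2 ^ 4 by norm_num, Real.log_pow]
      have := Real.log_two_lt_d9
      push_cast
      linarith
    rw [Real.log_pow] at h2
    nlinarith
  have hsq := sum_inv_sq_le ⌊Q⌋₊
  have hts : t ≤ 1 + t * √t := by
    rcases le_total t 1 with h1 | h1
    · have : 0 ≤ t * √t := by positivity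
      linarith
    · have : 1 ≤ √t := Real.one_le_sqrt.2 h1
      nlinarith
  calc _ ≤ Q * K₁ * (4 * L) + Q * (K₁ * t ^ 2 + K₂ * L * (t + t * √t)) * 2 := by gcongr
    _ ≤ Q * K₁ * (4 * L) + Q * (K₁ * t ^ 2 + K₂ * L * ((1 + t * √t) + (1 + t * √t))) * 2 := by
      gcongr
      linarith
    _ = Q * (4 * K₁ * L + 2 * K₁ * t ^ 2 + 4 * K₂ * (L * (1 + t * √t))) := by ring
    _ ≤ _ := by
      refine mul_le_mul_of_nonneg_left ?_ hQ.le
      have h1 : 0 ≤ K₁ * (L * (t * √t)) := by positivity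
      have h2 : 0 ≤ K₁ * t ^ 2 := by positivity
      have h3 : 0 ≤ K₂ * t ^ 2 := by positivity
      nlinarith

/-- A sum over rational points near, but not too near, a curve. -/
theorem sum_inv_mul_sqrt_le {C W : ℝ} (hC : 1 ≤ C) (hW : 0 ≤ W) :
    ∃ K : ℝ, 0 ≤ K ∧ ∀ h g hd gd : ℝ → ℝ, LegendrePair C h g hd gd →
      ∀ (L : ℕ) (J lam : ℝ), 1 ≤ J → J < 16 ^ L → 0 < lam → ∀ S : Finset (ℤ × ℤ × ℤ),
      (∀ P ∈ S, (0 < P.2.1 ∧ (P.2.1 : ℝ) ≤ J) ∧ |absc P| ≤ W ∧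
        2 * lam ≤ P.2.1 * |h (absc P) - ordi P| ∧ P.2.1 * |h (absc P) - ordi P| ≤ 1 / 2) →
      ∑ P ∈ S, 1 / (P.2.1 * √|h (absc P) - ordi P|)
        ≤ K * (L * √(J / lam) + L * (J * √√J) + J * √J) := by
  obtain ⟨K₃, hK₃, hcount⟩ := card_near_triples_le hC
  refine ⟨3072 * (16 * (2 * W + 1) * K₃), by positivity,
    fun h g hd gd D L J lam hJ hJL hlam S hS => ?_⟩
  have hJ0 : 0 < J := by linarith
  set A := 16 * (2 * W + 1) * K₃ with hA
  have hA0 : 0 ≤ A := by positivity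
  set m : ℤ × ℤ × ℤ → ℝ := fun P => √|h (absc P) - ordi P| with hm
  set ρ := √(2 * lam / J) with hρ
  have hρ0 : 0 < ρ := Real.sqrt_pos.2 (by positivity)
  have hmsq : ∀ P, m P ^ 2 = |h (absc P) - ordi P| := fun P => Real.sq_sqrt (abs_nonneg _)
  have hq : ∀ P ∈ S, (1 : ℝ) ≤ P.2.1 ∧ (P.2.1 : ℝ) ≤ J := fun P hP =>
    ⟨by exact_mod_cast (hS P hP).1.1, (hS P hP).1.2⟩
  have hρm : ∀ P ∈ S, ρ ≤ m P := by
    intro P hP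
    refine Real.sqrt_le_sqrt ?_
    rw [div_le_iff₀ hJ0]
    have h1 := (hS P hP).2.2.1
    have h2 : (P.2.1 : ℝ) * |h (absc P) - ordi P| ≤ J * |h (absc P) - ordi P| := by
      gcongr
      exact (hq P hP).2
    linarith
  obtain ⟨K, hK⟩ := sum_inv_mul_le_dyadic S (fun P => (P.2.1 : ℝ)) m (Y := J) hρ0 hJL hq hρm
  refine hK.trans ?_
  have hclass : ∀ j k : ℕ, 16 / (J / 16 ^ j * (16 ^ k * ρ)) * ((S.filter (fun P =>
      (J / 16 ^ j / 16 < (P.2.1 : ℝ) ∧ (P.2.1 : ℝ) ≤ J / 16 ^ j) ∧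
        (16 ^ k * ρ ≤ m P ∧ m P ≤ 16 ^ (k + 1) * ρ))).card : ℝ) ≤
      A * (L * (if 1 / ρ / 16 ^ k ≤ 16 * √(J / lam) / 4 ^ j then 1 / ρ / 16 ^ k else 0) +
        64 * L * (J / 16 ^ j) * (if √(ρ * (J / 16 ^ j)) * 4 ^ k ≤ 2 * √√J then
          √(ρ * (J / 16 ^ j)) * 4 ^ k else 0) +
        256 * (J / 16 ^ j) ^ 2 *
          (if ρ * 16 ^ k ≤ 3 / √(J / 16 ^ j) then ρ * 16 ^ k else 0)) := by
    intro j k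
    have h4j : (16 : ℝ) ^ j = (4 ^ j) ^ 2 := by rw [← pow_mul, mul_comm, pow_mul]; norm_num
    have h4k : (16 : ℝ) ^ k = (4 ^ k) ^ 2 := by rw [← pow_mul, mul_comm, pow_mul]; norm_num
    have hQJ : J / 16 ^ j ≤ J := div_le_self hJ0.le (one_le_pow₀ (by norm_num))
    have hsj : √(J / lam) / 4 ^ j = √(J / 16 ^ j / lam) := by
      rw [h4j, div_right_comm, Real.sqrt_div' (J / lam) (by positivity : (0 : ℝ) ≤ (4 ^ j) ^ 2),
        Real.sqrt_sq (by positivity)]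
    set Q := J / 16 ^ j with hQ
    have hQ0 : 0 < Q := by positivity
    set R := 16 ^ k * ρ with hR
    have hR0 : 0 < R := by positivity
    have hR' : 16 ^ (k + 1) * ρ = 16 * R := by rw [hR, pow_succ]; ring
    rw [hR']
    set S' := S.filter (fun P => (Q / 16 < (P.2.1 : ℝ) ∧ (P.2.1 : ℝ) ≤ Q) ∧
        (R ≤ m P ∧ m P ≤ 16 * R)) with hS'
    rcases S'.eq_empty_or_nonempty with he | ⟨P, hP⟩
    · rw [he, Finset.card_empty, Nat.cast_zero, mul_zero]
      refine mul_nonneg hA0 (add_nonneg (add_nonneg (mul_nonneg (by positivity) ?_)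
        (mul_nonneg (by positivity) ?_)) (mul_nonneg (by positivity) ?_)) <;>
      · split_ifs <;> positivity
    · obtain ⟨hPS, ⟨h1, h2⟩, h3, h4⟩ := Finset.mem_filter.1 hP
      obtain ⟨-, -, h5, h6⟩ := hS P hPS
      rw [← hmsq] at h5 h6
      have hR2Q : R ^ 2 * Q ≤ 8 := by
        have hP0 : (0 : ℝ) < P.2.1 := lt_trans (by positivity) h1
        have : Q / 16 * R ^ 2 ≤ P.2.1 * m P ^ 2 := by gcongr
        linarith
      have hlamQ : lam ≤ 256 * (R ^ 2 * Q) := by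
        have : P.2.1 * m P ^ 2 ≤ Q * (16 * R) ^ 2 := by
          have : 0 ≤ m P := Real.sqrt_nonneg _
          gcongr
        nlinarith
      have e1 : 1 / ρ / 16 ^ k = 1 / R := by rw [hR]; field_simp
      have e2 : √(ρ * Q) * 4 ^ k = √(R * Q) := by
        rw [hR, h4k, mul_assoc, Real.sqrt_mul (by positivity : (0 : ℝ) ≤ (4 ^ k) ^ 2),
          Real.sqrt_sq (by positivity), mul_comm]
      have e3 : ρ * 16 ^ k = R := mul_comm _ _
      have c1 : 1 / R ≤ 16 * √(J / lam) / 4 ^ j := by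
        rw [mul_div_assoc, hsj, div_le_iff₀ hR0]
        have : 1 ≤ √(256 * (Q / lam * R ^ 2)) := by
          rw [Real.one_le_sqrt, div_mul_eq_mul_div, ← mul_div_assoc, one_le_div hlam]
          linarith
        rw [Real.sqrt_mul (by norm_num), Real.sqrt_mul (by positivity), Real.sqrt_sq hR0.le,
          show (256 : ℝ) = 16 ^ 2 by norm_num, Real.sqrt_sq (by norm_num)] at this
        linarith
      have c2 : √(R * Q) ≤ 2 * √√J := by
        have h7 : R * Q ≤ 4 * √J := by
          refine abs_le_of_sq_le_sq' ?_ (by positivity) |>.2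
          rw [mul_pow 4, Real.sq_sqrt hJ0.le, show (R * Q) ^ 2 = R ^ 2 * Q * Q by ring]
          nlinarith
        calc √(R * Q) ≤ √(2 ^ 2 * √J) := Real.sqrt_le_sqrt (by linarith)
          _ = 2 * √√J := by
            rw [Real.sqrt_mul (by positivity), Real.sqrt_sq (by norm_num)]
      have c3 : R ≤ 3 / √Q := by
        rw [le_div_iff₀ (Real.sqrt_pos.2 hQ0)]
        refine abs_le_of_sq_le_sq' ?_ (by positivity) |>.2
        rw [mul_pow, Real.sq_sqrt hQ0.le]
        linarith
      rw [e1, e2, e3, if_pos c1, if_pos c2, if_pos c3]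
      have hcard : (S'.card : ℝ) ≤ (2 * W + 1) * (Q * (K₃ * (L * (1 + 16 * R * Q *
          √(16 * R * Q)) + (16 * R * Q) ^ 2))) := by
        refine card_le_of_unit_intervals S' absc (A := -W) (W := 2 * W) (by positivity)
          (by positivity) ?_ ?_
        · intro P hP
          have := abs_le.1 (hS P (Finset.mem_filter.1 hP).1).2.1
          constructor <;> linarith
        · intro z
          refine hcount L h g hd gd D z (16 * R) Q (by positivity) hQ0 (hQJ.trans_lt hJL) _ ?_
          intro P hP
          obtain ⟨hP', hPz⟩ := Finset.mem_filter.1 hP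
          obtain ⟨hPS, ⟨h1, h2⟩, h3, h4⟩ := Finset.mem_filter.1 hP'
          refine ⟨⟨(hS P hPS).1.1, h2⟩, hPz, ?_⟩
          rw [← hmsq]
          have : 0 ≤ m P := Real.sqrt_nonneg _
          gcongr
      refine (mul_le_mul_of_nonneg_left hcard (by positivity)).trans (le_of_eq ?_)
      have e4 : √(16 * R * Q) = 4 * √(R * Q) := by
        rw [mul_assoc, Real.sqrt_mul (by norm_num), show (16 : ℝ) = 4 ^ 2 by norm_num,
          Real.sqrt_sq (by norm_num)]
      rw [e4, hA]
      field_simp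
      ring
  have hsum : ∀ j : ℕ, ∑ k ∈ Finset.range K, 16 / (J / 16 ^ j * (16 ^ k * ρ)) *
      ((S.filter (fun P => (J / 16 ^ j / 16 < (P.2.1 : ℝ) ∧ (P.2.1 : ℝ) ≤ J / 16 ^ j) ∧
        (16 ^ k * ρ ≤ m P ∧ m P ≤ 16 ^ (k + 1) * ρ))).card : ℝ) ≤
      A * (32 * L * √(J / lam) * (1 / 4 ^ j) + (256 * L * (J * √√J) + 1536 * (J * √J)) *
        (1 / 16 ^ j)) := by
    intro j
    refine (Finset.sum_le_sum fun k _ => hclass j k).trans ?_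
    have hQJ : J / 16 ^ j ≤ J := div_le_self hJ0.le (one_le_pow₀ (by norm_num))
    have hQ0 : 0 < J / 16 ^ j := by positivity
    rw [← Finset.mul_sum, Finset.sum_add_distrib, Finset.sum_add_distrib, ← Finset.mul_sum,
      ← Finset.mul_sum, ← Finset.mul_sum, ← Finset.sum_filter, ← Finset.sum_filter,
      ← Finset.sum_filter]
    refine mul_le_mul_of_nonneg_left ?_ hA0
    have s1 := sum_inv_pow_capped_le K (a := 1 / ρ) (x := 16) (B := 16 * √(J / lam) / 4 ^ j)
      (by positivity) (by norm_num) (by positivity)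
    have s2 := sum_pow_capped_le K (a := √(ρ * (J / 16 ^ j))) (x := 4) (B := 2 * √√J)
      (by positivity) (by norm_num) (by positivity)
    have s3 := sum_pow_capped_le K (a := ρ) (x := 16) (B := 3 / √(J / 16 ^ j))
      (by positivity) (by norm_num) (by positivity)
    have e5 : (J / 16 ^ j) ^ 2 * (2 * (3 / √(J / 16 ^ j)))
        = 6 * ((J / 16 ^ j) * √(J / 16 ^ j)) := by
      have h1 : √(J / 16 ^ j) * √(J / 16 ^ j) = J / 16 ^ j := Real.mul_self_sqrt hQ0.le
      have h2 : 0 < √(J / 16 ^ j) := Real.sqrt_pos.2 hQ0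
      generalize √(J / 16 ^ j) = s at h1 h2 ⊢
      rw [← h1]
      field_simp
      ring
    have h7 : √(J / 16 ^ j) ≤ √J := Real.sqrt_le_sqrt hQJ
    calc _ ≤ L * (2 * (16 * √(J / lam) / 4 ^ j)) + 64 * L * (J / 16 ^ j) * (2 * (2 * √√J)) +
          256 * (J / 16 ^ j) ^ 2 * (2 * (3 / √(J / 16 ^ j))) := by gcongr
      _ = L * (2 * (16 * √(J / lam) / 4 ^ j)) + 64 * L * (J / 16 ^ j) * (2 * (2 * √√J)) +
          256 * (6 * ((J / 16 ^ j) * √(J / 16 ^ j))) := by rw [← e5]; ring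
      _ ≤ L * (2 * (16 * √(J / lam) / 4 ^ j)) + 64 * L * (J / 16 ^ j) * (2 * (2 * √√J)) +
          256 * (6 * ((J / 16 ^ j) * √J)) := by gcongr
      _ = _ := by ring
  refine (Finset.sum_le_sum fun j _ => hsum j).trans ?_
  rw [← Finset.mul_sum, Finset.sum_add_distrib, ← Finset.mul_sum, ← Finset.mul_sum]
  have g1 := sum_inv_pow_le L (x := 4) (by norm_num)
  have g2 := sum_inv_pow_le L (x := 16) (by norm_num)
  calc _ ≤ A * (32 * L * √(J / lam) * 2 + (256 * L * (J * √√J) + 1536 * (J * √J)) * 2) := by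
        gcongr
    _ ≤ A * (3072 * (L * √(J / lam) + L * (J * √√J) + J * √J)) := by
        have h1 : 0 ≤ L * √(J / lam) := by positivity
        have h2 : 0 ≤ L * (J * √√J) := by positivity
        refine mul_le_mul_of_nonneg_left ?_ hA0
        linarith
    _ = _ := by ring

lemma volume_le_of_pairwise_dist_le {A : Set ℝ} {d : ℝ}
    (h : ∀ x ∈ A, ∀ y ∈ A, |y - x| ≤ d) : volume A ≤ ENNReal.ofReal (2 * d) := by
  rcases A.eq_empty_or_nonempty with rfl | ⟨x, hx⟩
  · simp
  · have : A ⊆ Icc (x - d) (x + d) := fun y hy => by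
      have := abs_le.1 (h x hx y hy)
      constructor <;> linarith
    refine (measure_mono this).trans ?_
    rw [Real.volume_Icc]
    exact ENNReal.ofReal_le_ofReal (by linarith)

/-- The measure of the set on which the curve `h` is close to a line. -/
lemma LegendrePair.volume_strip_le {C : ℝ} {h g hd gd : ℝ → ℝ} (D : LegendrePair C h g hd gd)
    {s b w : ℝ} (hw : 0 < w) (hb : hd s ≠ b) {A : Set ℝ}
    (hA : ∀ x ∈ A, |h x - s * x + b| ≤ w) :
    (volume A).toReal ≤ 8 * C ^ 2 * (w / √|hd s - b|) := by
  have hC := D.one_le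
  have hm : 0 < √|hd s - b| := Real.sqrt_pos.2 (abs_pos.2 (sub_ne_zero.2 hb))
  set d := 2 * C ^ 2 * w / √|hd s - b| with hd'
  have hd0 : 0 ≤ d := by positivity
  have hdist : ∀ t, t * √(max |hd s - b| w) ≤ 2 * C ^ 2 * w → 0 ≤ t → t ≤ d := by
    intro t ht ht0
    rw [hd', le_div_iff₀ hm]
    refine le_trans ?_ ht
    gcongr
    exact le_max_left _ _
  have h1 : volume (A ∩ Ici (gd s)) ≤ ENNReal.ofReal (2 * d) :=
    volume_le_of_pairwise_dist_le fun x hx y hy =>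
      hdist _ (D.strip_right hw hx.2 hy.2 (hA x hx.1) (hA y hy.1)) (abs_nonneg _)
  have h2 : volume (A ∩ Iic (gd s)) ≤ ENNReal.ofReal (2 * d) :=
    volume_le_of_pairwise_dist_le fun x hx y hy =>
      hdist _ (D.strip_left hw hx.2 hy.2 (hA x hx.1) (hA y hy.1)) (abs_nonneg _)
  have h3 : volume A ≤ ENNReal.ofReal (4 * d) := by
    calc volume A ≤ volume ((A ∩ Ici (gd s)) ∪ (A ∩ Iic (gd s))) :=
          measure_mono fun x hx => (le_total (gd s) x).imp (fun h => ⟨hx, h⟩) fun h => ⟨hx, h⟩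
      _ ≤ ENNReal.ofReal (2 * d) + ENNReal.ofReal (2 * d) :=
          (measure_union_le _ _).trans (add_le_add h1 h2)
      _ = ENNReal.ofReal (4 * d) := by
          rw [← ENNReal.ofReal_add (by positivity) (by positivity)]
          ring_nf
  refine (ENNReal.toReal_le_of_le_ofReal (by positivity) h3).trans (le_of_eq ?_)
  rw [hd']
  ring

/-- The sum over lines with a given sign of the leading coefficient. -/
lemma sum_volume_pos_le {C W K : ℝ} {h g hd gd : ℝ → ℝ} (D : LegendrePair C h g hd gd)
    {J lam : ℝ} (hlam : 0 < lam)
    (hK : ∀ S : Finset (ℤ × ℤ × ℤ),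
      (∀ P ∈ S, (0 < P.2.1 ∧ (P.2.1 : ℝ) ≤ J) ∧ |absc P| ≤ W ∧
        2 * lam ≤ P.2.1 * |hd (absc P) - ordi P| ∧ P.2.1 * |hd (absc P) - ordi P| ≤ 1 / 2) →
      ∑ P ∈ S, 1 / (P.2.1 * √|hd (absc P) - ordi P|) ≤ K)
    (I : Set ℝ) (p : ℤ × ℤ → ℤ) (ε : ℤ) (hε : ε = 1 ∨ ε = -1) (S : Finset (ℤ × ℤ))
    (hS : ∀ j ∈ S, (0 < ε * j.2 ∧ |(j.2 : ℝ)| ≤ J) ∧ |(j.1 : ℝ)| ≤ W * |(j.2 : ℝ)| ∧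
      2 * lam ≤ |j.2 * hd (j.1 / j.2) - p j| ∧ |j.2 * hd (j.1 / j.2) - p j| ≤ 1 / 2) :
    ∑ j ∈ S, (volume {x ∈ I | |(j.1 : ℝ) * x - j.2 * h x - p j| < lam}).toReal
      ≤ 8 * C ^ 2 * lam * K := by
  have hC := D.one_le
  set φ : ℤ × ℤ → ℤ × ℤ × ℤ := fun j => (ε * j.1, ε * j.2, ε * p j) with hφ
  have hεε : ε * ε = 1 := by rcases hε with rfl | rfl <;> norm_num
  have hεR : (ε : ℝ) * ε = 1 := by exact_mod_cast hεε
  have hε0 : (ε : ℝ) ≠ 0 := left_ne_zero_of_mul_eq_one hεR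
  have hεa : |(ε : ℝ)| = 1 := by rcases hε with rfl | rfl <;> norm_num
  have hinj : Function.Injective φ := by
    intro i j hij
    simp only [hφ, Prod.mk.injEq] at hij
    have h0 : ε ≠ 0 := by rintro rfl; simp at hεε
    exact Prod.ext (mul_left_cancel₀ h0 hij.1) (mul_left_cancel₀ h0 hij.2.1)
  have habsc : ∀ j, absc (φ j) = j.1 / j.2 := fun j => by
    simp only [absc, hφ, Int.cast_mul]
    exact mul_div_mul_left _ _ hε0
  have hordi : ∀ j, ordi (φ j) = p j / j.2 := fun j => by
    simp only [ordi, hφ, Int.cast_mul]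
    exact mul_div_mul_left _ _ hε0
  have hq : ∀ j ∈ S, ((φ j).2.1 : ℝ) = |(j.2 : ℝ)| ∧ 0 < |(j.2 : ℝ)| := fun j hj => by
    have h1 : (0 : ℝ) < ε * j.2 := by exact_mod_cast (hS j hj).1.1
    have h2 : ((φ j).2.1 : ℝ) = |(j.2 : ℝ)| := by
      simp only [hφ, Int.cast_mul]
      rw [← abs_of_pos h1, abs_mul, hεa, one_mul]
    refine ⟨h2, ?_⟩
    rw [← h2]
    simpa [hφ] using h1
  have hqm : ∀ j ∈ S, |(j.2 : ℝ)| * |hd (j.1 / j.2) - p j / j.2| =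
      |j.2 * hd (j.1 / j.2) - p j| := fun j hj => by
    have := abs_pos.1 (hq j hj).2
    rw [← abs_mul, mul_sub, mul_div_cancel₀ _ this]
  have hsum := hK (S.map ⟨φ, hinj⟩) (by
    intro P hP
    obtain ⟨j, hj, rfl⟩ := Finset.mem_map.1 hP
    obtain ⟨⟨h1, h2⟩, h3, h4, h5⟩ := hS j hj
    obtain ⟨h6, h7⟩ := hq j hj
    simp only [Function.Embedding.coeFn_mk]
    rw [habsc, hordi, h6, hqm j hj]
    refine ⟨⟨h1, h2⟩, ?_, h4, h5⟩
    rw [abs_div, div_le_iff₀ h7]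
    exact h3)
  rw [Finset.sum_map] at hsum
  refine le_trans ?_ (mul_le_mul_of_nonneg_left hsum (by positivity))
  rw [Finset.mul_sum]
  refine Finset.sum_le_sum fun j hj => ?_
  obtain ⟨-, -, h4, -⟩ := hS j hj
  obtain ⟨h6, h7⟩ := hq j hj
  have hj0 : (j.2 : ℝ) ≠ 0 := abs_pos.1 h7
  simp only [Function.Embedding.coeFn_mk]
  rw [habsc, hordi, h6]
  refine (D.volume_strip_le (s := j.1 / j.2) (b := p j / j.2) (w := lam / |(j.2 : ℝ)|)
    (by positivity) ?_ ?_).trans (le_of_eq ?_)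
  · intro he
    rw [he, mul_div_cancel₀ _ hj0, sub_self, abs_zero] at h4
    linarith
  · rintro x ⟨-, hx⟩
    rw [le_div_iff₀ h7, ← abs_mul]
    rw [show (h x - j.1 / j.2 * x + p j / j.2) * (j.2 : ℝ) = -(j.1 * x - j.2 * h x - p j) by
      field_simp; ring, abs_neg]
    exact hx.le
  · field_simp

theorem sum_volume_le {C W : ℝ} (hC : 1 ≤ C) (hW : 0 ≤ W) :
    ∃ K : ℝ, 0 ≤ K ∧ ∀ h g hd gd : ℝ → ℝ, LegendrePair C h g hd gd →
      ∀ (L : ℕ) (J lam : ℝ), 1 ≤ J → J < 16 ^ L → 0 < lam →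
      ∀ (I : Set ℝ) (p : ℤ × ℤ → ℤ) (S : Finset (ℤ × ℤ)),
      (∀ j ∈ S, (j.2 ≠ 0 ∧ |(j.2 : ℝ)| ≤ J) ∧ |(j.1 : ℝ)| ≤ W * |(j.2 : ℝ)| ∧
        2 * lam ≤ |j.2 * hd (j.1 / j.2) - p j| ∧ |j.2 * hd (j.1 / j.2) - p j| ≤ 1 / 2) →
      ∑ j ∈ S, (volume {x ∈ I | |(j.1 : ℝ) * x - j.2 * h x - p j| < lam}).toReal
        ≤ K * (lam * (L * √(J / lam) + L * (J * √√J) + J * √J)) := by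
  obtain ⟨K, hK, hbound⟩ := sum_inv_mul_sqrt_le hC hW
  refine ⟨16 * C ^ 2 * K, by positivity, fun h g hd gd D L J lam hJ hJL hlam I p S hS => ?_⟩
  have hb := hbound hd gd h g D.swap L J lam hJ hJL hlam
  have h1 := sum_volume_pos_le D hlam hb I p 1 (Or.inl rfl) (S.filter fun j => 0 < j.2)
    fun j hj => by
      obtain ⟨hj, hj2⟩ := Finset.mem_filter.1 hj
      obtain ⟨⟨-, h2⟩, h3⟩ := hS j hj
      exact ⟨⟨by linarith, h2⟩, h3⟩
  have h2 := sum_volume_pos_le D hlam hb I p (-1) (Or.inr rfl) (S.filter fun j => ¬ 0 < j.2)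
    fun j hj => by
      obtain ⟨hj, hj2⟩ := Finset.mem_filter.1 hj
      obtain ⟨⟨h1, h2⟩, h3⟩ := hS j hj
      exact ⟨⟨by omega, h2⟩, h3⟩
  rw [← Finset.sum_filter_add_sum_filter_not S (fun j => 0 < j.2)]
  refine (add_le_add h1 h2).trans (le_of_eq ?_)
  ring

lemma natLog_add_one_le {J : ℕ} (hJ : 2 ≤ J) : ((Nat.log 16 J + 1 : ℕ) : ℝ) ≤ 3 * Real.log J := by
  have hJ0 : J ≠ 0 := by omega
  have h1 : (16 : ℝ) ^ Nat.log 16 J ≤ J := by exact_mod_cast Nat.pow_log_le_self 16 hJ0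
  have h2 := Real.log_le_log (by positivity) h1
  rw [Real.log_pow] at h2
  have h3 : Real.log 2 ≤ Real.log J := Real.log_le_log (by norm_num) (by exact_mod_cast hJ)
  have h4 := Real.log_two_gt_d9
  have h5 : Real.log 16 = 4 * Real.log 2 := by
    rw [show (16 : ℝ) = 2 ^ 4 by norm_num, Real.log_pow]
    norm_num
  have h6 : (0 : ℝ) ≤ Nat.log 16 J := by positivity
  push_cast
  nlinarith

lemma log_le_sqrt_sqrt {x : ℝ} (hx : 0 < x) : Real.log x ≤ 4 * √√x := by
  have h1 := Real.log_le_sub_one_of_pos (Real.sqrt_pos.2 (Real.sqrt_pos.2 hx))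
  rw [Real.log_sqrt (Real.sqrt_nonneg _), Real.log_sqrt hx.le] at h1
  linarith

theorem sum_volume_log_le {C W : ℝ} (hC : 1 ≤ C) (hW : 0 ≤ W) :
    ∃ K : ℝ, 0 < K ∧ ∀ h g hd gd : ℝ → ℝ, LegendrePair C h g hd gd →
      ∀ J : ℕ, 2 ≤ J → ∀ lam : ℝ, 0 < lam →
      ∀ (I : Set ℝ) (p : ℤ × ℤ → ℤ) (S : Finset (ℤ × ℤ)),
      (∀ j ∈ S, (j.2 ≠ 0 ∧ |(j.2 : ℝ)| ≤ J) ∧ |(j.1 : ℝ)| ≤ W * |(j.2 : ℝ)| ∧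
        2 * lam ≤ |j.2 * hd (j.1 / j.2) - p j| ∧ |j.2 * hd (j.1 / j.2) - p j| ≤ 1 / 2) →
      ∑ j ∈ S, (volume {x ∈ I | |(j.1 : ℝ) * x - j.2 * h x - p j| < lam}).toReal
        ≤ K * (lam ^ ((1 : ℝ) / 2) * (J : ℝ) ^ ((1 : ℝ) / 2) * Real.log J
              + lam * (J : ℝ) ^ ((3 : ℝ) / 2)) := by
  obtain ⟨K, hK, hbound⟩ := sum_volume_le hC hW
  refine ⟨13 * K + 1, by positivity, fun h g hd gd D J hJ lam hlam I p S hS => ?_⟩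
  have hJ1 : (1 : ℝ) ≤ J := by exact_mod_cast (by omega : 1 ≤ J)
  have hJ0 : (0 : ℝ) < J := by linarith
  set L := Nat.log 16 J + 1 with hL
  have hJL : (J : ℝ) < 16 ^ L := by exact_mod_cast Nat.lt_pow_succ_log_self (by norm_num) J
  refine (hbound h g hd gd D L J lam hJ1 hJL hlam I p S hS).trans ?_
  have hL3 : (L : ℝ) ≤ 3 * Real.log J := natLog_add_one_le hJ
  have hlog := log_le_sqrt_sqrt hJ0
  have hlog0 : 0 ≤ Real.log J := Real.log_nonneg hJ1
  have e1 : (J : ℝ) ^ ((3 : ℝ) / 2) = J * √J := by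
    rw [Real.sqrt_eq_rpow, show (3 : ℝ) / 2 = 1 + 1 / 2 by norm_num, Real.rpow_add hJ0,
      Real.rpow_one]
  rw [← Real.sqrt_eq_rpow, ← Real.sqrt_eq_rpow, e1]
  have e2 : lam * √(J / lam) = √lam * √J := by
    have h1 : 0 < √lam := Real.sqrt_pos.2 hlam
    rw [Real.sqrt_div hJ0.le]
    nth_rewrite 1 [← Real.mul_self_sqrt hlam.le]
    field_simp
  have e3 : √√(J : ℝ) * √√J = √J := Real.mul_self_sqrt (Real.sqrt_nonneg _)
  have f1 : lam * (L * √(J / lam)) ≤ 3 * (√lam * √J * Real.log J) := by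
    calc lam * (L * √(J / lam)) = (lam * √(J / lam)) * L := by ring
      _ ≤ (√lam * √J) * (3 * Real.log J) := by rw [e2]; gcongr
      _ = _ := by ring
  have f2 : L * (J * √√J) ≤ 12 * (J * √J) := by
    calc L * (J * √√J) ≤ (12 * √√J) * (J * √√J) := by
          gcongr
          linarith
      _ = 12 * (J * (√√J * √√J)) := by ring
      _ = _ := by rw [e3]
  have f3 : 0 ≤ √lam * √J * Real.log J := by positivity
  have f4 : 0 ≤ lam * (J * √J) := by positivity
  have f5 : lam * (L * √(J / lam) + L * (J * √√J) + J * √J) ≤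
      13 * (√lam * √J * Real.log J + lam * (J * √J)) := by nlinarith
  calc K * (lam * (L * √(J / lam) + L * (J * √√J) + J * √J)) ≤
        K * (13 * (√lam * √J * Real.log J + lam * (J * √J))) := by gcongr
    _ ≤ _ := by linarith

/-- A convex function lies above its tangent lines. -/
lemma tangent_le_of_monotone_deriv {φ φ' : ℝ → ℝ} (hφ : ∀ x, HasDerivAt φ (φ' x) x)
    (hmono : Monotone φ') (u v : ℝ) : φ' u * (v - u) ≤ φ v - φ u := by
  have hcont : Continuous φ := continuous_iff_continuousAt.2 fun x => (hφ x).continuousAt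
  rcases lt_trichotomy u v with huv | rfl | huv
  · obtain ⟨c, hc, he⟩ := exists_hasDerivAt_eq_slope φ φ' huv hcont.continuousOn fun x _ => hφ x
    rw [eq_div_iff (by linarith)] at he
    rw [← he]
    exact mul_le_mul_of_nonneg_right (hmono hc.1.le) (by linarith)
  · simp
  · obtain ⟨c, hc, he⟩ := exists_hasDerivAt_eq_slope φ φ' huv hcont.continuousOn fun x _ => hφ x
    rw [eq_div_iff (by linarith)] at he
    have := mul_le_mul_of_nonneg_right (hmono hc.2.le) (by linarith : 0 ≤ u - v)
    linarith

lemma exists_legendrePair {c₁ c₂ : ℝ} (hc₁ : 0 < c₁) (hc₁₂ : c₁ ≤ c₂) :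
    ∃ C : ℝ, 1 ≤ C ∧ ∀ h g g2 hd gd : ℝ → ℝ, (∀ x, HasDerivAt h (g x) x) →
      (∀ x, HasDerivAt g (g2 x) x) → (∀ x, c₁ ≤ g2 x ∧ g2 x ≤ c₂) → (∀ u, gd (g u) = u) →
      (∀ s, g (gd s) = s) → (∀ u, hd (g u) = u * g u - h u) → LegendrePair C h g hd gd := by
  have hc₂ : 0 < c₂ := by linarith
  set C := 1 + 2 / c₁ + c₂ + 2 * c₂ ^ 2 / c₁ + c₂ / c₁ ^ 2 with hC
  have p1 : 0 < 2 / c₁ := by positivity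
  have p2 : 0 < 2 * c₂ ^ 2 / c₁ := by positivity
  have p3 : 0 < c₂ / c₁ ^ 2 := by positivity
  have hC1 : 1 ≤ C := by linarith
  have a1 : 2 ≤ C * c₁ := by
    have : 2 / c₁ * c₁ = 2 := by field_simp
    nlinarith
  have a2 : c₂ ≤ C := by linarith
  have a3 : 2 * c₂ ^ 2 ≤ C * c₁ := by
    have : 2 * c₂ ^ 2 / c₁ * c₁ = 2 * c₂ ^ 2 := by field_simp
    nlinarith
  have a4 : c₂ ≤ C * c₁ ^ 2 := by
    have : c₂ / c₁ ^ 2 * c₁ ^ 2 = c₂ := by field_simp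
    nlinarith [sq_nonneg c₁]
  refine ⟨C, hC1, fun h g g2 hd gd hh hg hg2 hgd1 hgd2 hdual => ?_⟩
  have m1' : ∀ x, HasDerivAt (fun x => g x - c₁ * x) (g2 x - c₁ * 1) x := fun x =>
    (hg x).sub ((hasDerivAt_id x).const_mul c₁)
  have m1 : Monotone fun x => g x - c₁ * x :=
    monotone_of_deriv_nonneg (fun x => (m1' x).differentiableAt) fun x => by
      rw [(m1' x).deriv]
      linarith [(hg2 x).1]
  have m2' : ∀ x, HasDerivAt (fun x => c₂ * x - g x) (c₂ * 1 - g2 x) x := fun x =>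
    ((hasDerivAt_id x).const_mul c₂).sub (hg x)
  have m2 : Monotone fun x => c₂ * x - g x :=
    monotone_of_deriv_nonneg (fun x => (m2' x).differentiableAt) fun x => by
      rw [(m2' x).deriv]
      linarith [(hg2 x).2]
  have b1 : ∀ u v, c₁ / 2 * (v - u) ^ 2 ≤ h v - h u - g u * (v - u) := fun u v => by
    have := tangent_le_of_monotone_deriv (φ := fun x => h x - c₁ / 2 * x ^ 2)
      (fun x => ((hh x).sub (((hasDerivAt_id x).pow 2).const_mul (c₁ / 2))).congr_deriv
        (by simp; ring)) m1 u v
    linarith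
  have b2 : ∀ u v, h v - h u - g u * (v - u) ≤ c₂ / 2 * (v - u) ^ 2 := fun u v => by
    have := tangent_le_of_monotone_deriv (φ := fun x => c₂ / 2 * x ^ 2 - h x)
      (fun x => ((((hasDerivAt_id x).pow 2).const_mul (c₂ / 2)).sub (hh x)).congr_deriv
        (by simp; ring)) m2 u v
    linarith
  have d : ∀ x y, c₁ ^ 2 * (x - y) ^ 2 ≤ (g x - g y) ^ 2 ∧
      (g x - g y) ^ 2 ≤ c₂ ^ 2 * (x - y) ^ 2 := by
    have key : ∀ x y, y ≤ x → c₁ ^ 2 * (x - y) ^ 2 ≤ (g x - g y) ^ 2 ∧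
        (g x - g y) ^ 2 ≤ c₂ ^ 2 * (x - y) ^ 2 := by
      intro x y hxy
      have h1 := m1 hxy
      have h2 := m2 hxy
      simp only at h1 h2
      have h3 : 0 ≤ c₁ * (x - y) := mul_nonneg hc₁.le (by linarith)
      rw [← mul_pow, ← mul_pow]
      exact ⟨pow_le_pow_left₀ h3 (by linarith) 2, pow_le_pow_left₀ (by linarith) (by linarith) 2⟩
    intro x y
    rcases le_total y x with hxy | hxy
    · exact key x y hxy
    · have := key y x hxy
      rwa [← neg_sub x y, ← neg_sub (g x), neg_sq, neg_sq] at this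
  have hdg : ∀ s, hd s = gd s * s - h (gd s) := fun s => by
    have := hdual (gd s)
    rwa [hgd2] at this
  have hB : ∀ s t, hd t - hd s - gd s * (t - s) =
      h (gd s) - h (gd t) - g (gd t) * (gd s - gd t) := fun s t => by
    rw [hdg, hdg, hgd2]
    ring
  have dd : ∀ s t, c₁ ^ 2 * (gd s - gd t) ^ 2 ≤ (t - s) ^ 2 ∧
      (t - s) ^ 2 ≤ c₂ ^ 2 * (gd s - gd t) ^ 2 := fun s t => by
    have := d (gd s) (gd t)
    rwa [hgd2, hgd2, ← neg_sub t s, neg_sq] at this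
  refine ⟨hC1, hgd1, hgd2, hdual, fun u v => ?_, fun u v => ?_, fun s t => ?_, fun s t => ?_⟩
  · have := mul_le_mul_of_nonneg_left (b1 u v) (by linarith : 0 ≤ C)
    nlinarith [sq_nonneg (v - u)]
  · nlinarith [b2 u v, sq_nonneg (v - u)]
  · rw [hB]
    have := mul_le_mul_of_nonneg_left (b1 (gd t) (gd s)) (by linarith : 0 ≤ C)
    nlinarith [sq_nonneg (gd s - gd t), (dd s t).2]
  · rw [hB]
    have h1 := b2 (gd t) (gd s)
    have h2 := mul_le_mul_of_nonneg_left (dd s t).1 (by linarith : 0 ≤ C)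
    nlinarith [sq_nonneg (gd s - gd t)]

lemma abs_sub_ceil_sub_half_le (y : ℝ) :
    nint y ≤ |y - ⌈y - 1 / 2⌉| ∧ |y - ⌈y - 1 / 2⌉| ≤ 1 / 2 := by
  refine ⟨round_le y _, ?_⟩
  have h1 := Int.le_ceil (y - 1 / 2)
  have h2 := Int.ceil_lt_add_one (y - 1 / 2)
  rw [abs_le]
  constructor <;> linarith

theorem sum_mu_p0_large_norm_bound
    (ξ η c₁ c₂ : ℝ) (hξη : ξ ≤ η) (hc₁ : 0 < c₁) (hc₁₂ : c₁ ≤ c₂)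
    (f f' f'' g : ℝ → ℝ)
    (hf : ∀ x, HasDerivAt f (f' x) x)
    (hf' : ∀ x, HasDerivAt f' (f'' x) x)
    (hf'' : Continuous f'')
    (hbd : ∀ x, c₁ ≤ |f'' x| ∧ |f'' x| ≤ c₂)
    (hg1 : ∀ y, f' (g y) = -y)
    (hg2 : ∀ x, g (-f' x) = x)
    (Mmax : ℝ) (hM : IsGreatest ((fun x => |f' x|) '' Icc ξ η) Mmax)
    (F : ℤ × ℤ → ℝ)
    (hF : ∀ j : ℤ × ℤ,
      F j = (j.1 : ℝ) * g ((j.1 : ℝ) / (j.2 : ℝ)) + (j.2 : ℝ) * f (g ((j.1 : ℝ) / (j.2 : ℝ)))) :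
    ∃ K : ℝ, 0 < K ∧ ∀ J : ℕ, 2 ≤ J → ∀ lam : ℝ, 0 < lam → lam ≤ 1/8 →
      ∑ j ∈ (Finset.Icc (-(J : ℤ)) J ×ˢ Finset.Icc (-(J : ℤ)) J).filter
          (fun j => j.2 ≠ 0 ∧ |(j.1 : ℝ)| ≤ 2 * (1 + Mmax) * |(j.2 : ℝ)| ∧
            2 * lam ≤ nint (F j)),
        (volume {x ∈ Icc ξ η |
          |(j.1 : ℝ) * x + (j.2 : ℝ) * f x - ((⌈F j - 1/2⌉ : ℤ) : ℝ)| < lam}).toReal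
      ≤ K * (lam ^ ((1 : ℝ)/2) * (J : ℝ) ^ ((1 : ℝ)/2) * Real.log J
              + lam * (J : ℝ) ^ ((3 : ℝ)/2)) := by
  have hMmax : 0 ≤ Mmax := by
    obtain ⟨x, -, hx⟩ := hM.1
    rw [← hx]
    exact abs_nonneg _
  obtain ⟨C, hC, hpair⟩ := exists_legendrePair hc₁ hc₁₂
  obtain ⟨K, hK, hbound⟩ := sum_volume_log_le (W := 2 * (1 + Mmax)) hC (by positivity)
  refine ⟨K, hK, fun J hJ lam hlam _ => ?_⟩
  set S := (Finset.Icc (-(J : ℤ)) J ×ˢ Finset.Icc (-(J : ℤ)) J).filter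
    (fun j => j.2 ≠ 0 ∧ |(j.1 : ℝ)| ≤ 2 * (1 + Mmax) * |(j.2 : ℝ)| ∧ 2 * lam ≤ nint (F j)) with hS
  have hmem : ∀ j ∈ S, (j.2 ≠ 0 ∧ |(j.2 : ℝ)| ≤ J) ∧
      |(j.1 : ℝ)| ≤ 2 * (1 + Mmax) * |(j.2 : ℝ)| ∧
      2 * lam ≤ |F j - ⌈F j - 1 / 2⌉| ∧ |F j - ⌈F j - 1 / 2⌉| ≤ 1 / 2 := by
    intro j hj
    obtain ⟨hj1, h1, h2, h3⟩ := Finset.mem_filter.1 hj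
    have h4 := Finset.mem_Icc.1 (Finset.mem_product.1 hj1).2
    obtain ⟨h5, h6⟩ := abs_sub_ceil_sub_half_le (F j)
    refine ⟨⟨h1, ?_⟩, h2, h3.trans h5, h6⟩
    exact_mod_cast abs_le.2 h4
  have hne : ∀ x, f'' x ≠ 0 := fun x h0 => by
    have := (hbd x).1
    rw [h0, abs_zero] at this
    linarith
  have hsign : (∀ x, 0 < f'' x) ∨ ∀ x, f'' x < 0 := by
    by_contra hcon
    push Not at hcon
    obtain ⟨⟨x, hx⟩, y, hy⟩ := hcon
    obtain ⟨z, hz⟩ := mem_range_of_exists_le_of_exists_ge hf'' ⟨x, hx⟩ ⟨y, hy⟩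
    exact hne z hz
  rcases hsign with hpos | hneg
  · have D : LegendrePair C f f' (fun s => s * g (-s) - f (g (-s))) (fun s => g (-s)) := by
      refine hpair _ _ f'' _ _ hf hf' (fun x => ?_) hg2 (fun s => by rw [hg1, neg_neg]) fun u => ?_
      · have := hbd x
        rwa [abs_of_pos (hpos x)] at this
      · simp only [hg2]
        ring
    obtain ⟨ψ, hψ⟩ : ∃ ψ : ℤ × ℤ ↪ ℤ × ℤ, ∀ j, ψ j = (j.1, -j.2) :=
      ⟨⟨fun j => (j.1, -j.2), fun i j hij => by
        simp only [Prod.mk.injEq, neg_inj] at hij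
        exact Prod.ext hij.1 hij.2⟩, fun _ => rfl⟩
    have hmain := hbound _ _ _ _ D J hJ lam hlam (Icc ξ η)
      (fun j => ⌈F (j.1, -j.2) - 1 / 2⌉) (S.map ψ) (by
        intro i hi
        obtain ⟨j, hj, rfl⟩ := Finset.mem_map.1 hi
        have hFj : ((-j.2 : ℤ) : ℝ) * ((j.1 / ((-j.2 : ℤ) : ℝ)) * g (-(j.1 / ((-j.2 : ℤ) : ℝ))) -
            f (g (-(j.1 / ((-j.2 : ℤ) : ℝ))))) = F j := by
          have : (j.2 : ℝ) ≠ 0 := by exact_mod_cast (hmem j hj).1.1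
          rw [hF, Int.cast_neg, div_neg, neg_neg]
          field_simp
          ring
        simp only [hψ, neg_neg]
        rw [hFj]
        simpa using hmem j hj)
    rw [Finset.sum_map] at hmain
    refine le_trans (le_of_eq (Finset.sum_congr rfl fun j _ => ?_)) hmain
    simp [hψ]
  · have D : LegendrePair C (fun x => -f x) (fun x => -f' x) (fun s => s * g s + f (g s)) g := by
      refine hpair _ _ (fun x => -f'' x) _ _ (fun x => (hf x).neg) (fun x => (hf' x).neg)
        (fun x => ?_) hg2 (fun s => by rw [hg1, neg_neg]) fun u => ?_
      · have := hbd x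
        rwa [abs_of_neg (hneg x)] at this
      · simp only [hg2]
        ring
    have hmain := hbound _ _ _ _ D J hJ lam hlam (Icc ξ η) (fun j => ⌈F j - 1 / 2⌉) S (by
        intro j hj
        have hFj : (j.2 : ℝ) * (j.1 / j.2 * g (j.1 / j.2) + f (g (j.1 / j.2))) = F j := by
          have : (j.2 : ℝ) ≠ 0 := by exact_mod_cast (hmem j hj).1.1
          rw [hF]
          field_simp
        rw [hFj]
        exact hmem j hj)
    refine le_trans (le_of_eq (Finset.sum_congr rfl fun j _ => ?_)) hmain
    simp
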